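/- arXiv:2508.01094 — 3 statements merged into one kernel-verified Lean document; each statement's English description precedes it below -/
import Mathlib

section
/- Let E ⊆ R^{m×n}\{0} and suppose there exists a nonzero Lipschitz function u ∈ W_0^{1,∞}(Ω; R^m) on an open bounded set Ω ⊆ R^n with Du(x) ∈ E almost everywhere. Then dim span E ≥ n. -/
noncomputable section
open Matrix MeasureTheory

/-- The (a.e. defined) Jacobian matrix of `u : ℝⁿ → ℝᵐ`. -/
def jac {m n : ℕ} (u : (Fin n → ℝ) → (Fin m → ℝ)) (x : Fin n → ℝ) :
    Matrix (Fin m) (Fin n) ℝ :=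
  Matrix.of fun i j => fderiv ℝ u x (Pi.single j 1) i

/-- A compactly supported Lipschitz function whose derivative in a direction `v ≠ 0` vanishes
almost everywhere has zero integral. -/
lemma LipschitzWith.integral_eq_zero_of_lineDeriv_ae_eq_zero {n : ℕ} {g : (Fin n → ℝ) → ℝ}
    {C : NNReal} (hg : LipschitzWith C g) (hgc : HasCompactSupport g) {v : Fin n → ℝ}
    (φ : (Fin n → ℝ) →L[ℝ] ℝ) (hφ : φ v ≠ 0)
    (h : ∀ᵐ x ∂(volume : Measure (Fin n → ℝ)), lineDeriv ℝ g x (-v) = 0) :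
    ∫ x, g x = 0 := by
  have key := LipschitzWith.integral_lineDeriv_mul_eq (μ := volume) φ.lipschitz hg hgc v
  have h1 : ∀ x, lineDeriv ℝ φ x v = φ v := fun x => by
    rw [(φ.differentiableAt (x := x)).lineDeriv_eq_fderiv, φ.fderiv]
  have h2 : ∫ x, lineDeriv ℝ g x (-v) * φ x = 0 := by
    refine integral_eq_zero_of_ae ?_
    filter_upwards [h] with x hx
    simp [hx]
  simp_rw [h1] at key
  rw [h2, integral_const_mul] at key
  exact (mul_eq_zero.mp key).resolve_left hφ

/-- The square of a compactly supported Lipschitz function is Lipschitz. -/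
lemma LipschitzWith.exists_sq_of_hasCompactSupport {n : ℕ} {f : (Fin n → ℝ) → ℝ} {C : NNReal}
    (hf : LipschitzWith C f) (hfc : HasCompactSupport f) :
    ∃ K, LipschitzWith K (fun x => f x * f x) := by
  obtain ⟨M, hM⟩ := hf.continuous.bounded_above_of_compact_support hfc
  have hM0 : 0 ≤ M := (norm_nonneg _).trans (hM 0)
  refine ⟨(2 * M * C).toNNReal, LipschitzWith.of_dist_le_mul fun x y => ?_⟩
  rw [Real.coe_toNNReal _ (by positivity), Real.dist_eq, mul_self_sub_mul_self, abs_mul]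
  have h1 : |f x + f y| ≤ 2 * M := by
    have hx := hM x
    have hy := hM y
    rw [Real.norm_eq_abs] at hx hy
    linarith [abs_add_le (f x) (f y)]
  have h2 : |f x - f y| ≤ C * dist x y := by
    simpa [Real.dist_eq] using hf.dist_le_mul x y
  calc |f x + f y| * |f x - f y| ≤ (2 * M) * (C * dist x y) := by gcongr
    _ = 2 * M * C * dist x y := by ring

/-- A compactly supported Lipschitz function whose derivative in a direction `v ≠ 0` vanishes
at almost every point where the function is nonzero is identically zero. -/
lemma LipschitzWith.eq_zero_of_fderiv_ae_eq_zero {n : ℕ} {f : (Fin n → ℝ) → ℝ}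
    {C : NNReal} (hf : LipschitzWith C f) (hfc : HasCompactSupport f) {v : Fin n → ℝ}
    (φ : (Fin n → ℝ) →L[ℝ] ℝ) (hφ : φ v ≠ 0)
    (h : ∀ᵐ x ∂(volume : Measure (Fin n → ℝ)), f x ≠ 0 → fderiv ℝ f x v = 0) :
    f = 0 := by
  obtain ⟨K, hK⟩ := hf.exists_sq_of_hasCompactSupport hfc
  have hgc : HasCompactSupport (fun x => f x * f x) := hfc.mul_right
  have hint : ∫ x, f x * f x = 0 := by
    refine hK.integral_eq_zero_of_lineDeriv_ae_eq_zero hgc φ hφ ?_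
    filter_upwards [h, hf.ae_differentiableAt (μ := volume)] with x hx hd
    rw [(hd.fun_mul hd).lineDeriv_eq_fderiv, fderiv_fun_mul hd hd]
    by_cases h0 : f x = 0
    · simp [h0]
    · simp [hx h0]
  have hae := (integral_eq_zero_iff_of_nonneg (fun x => mul_self_nonneg (f x))
    (hK.continuous.integrable_of_hasCompactSupport hgc)).mp hint
  have hz := (hK.continuous.ae_eq_iff_eq volume continuous_zero).mp hae
  funext x
  exact mul_self_eq_zero.mp (congrFun hz x)

/-- If `E ⊆ ℝ^{m×n} \ {0}` and there is a nonzero Lipschitz map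
`u ∈ W₀^{1,∞}(Ω; ℝᵐ)` (extended by zero outside the open bounded set `Ω ⊆ ℝⁿ`) with
`Du ∈ E` a.e. in `Ω`, then `dim span E ≥ n`. -/
theorem stmt6 {m n : ℕ} (Ω : Set (Fin n → ℝ)) (hΩo : IsOpen Ω) (hΩb : Bornology.IsBounded Ω)
    (E : Set (Matrix (Fin m) (Fin n) ℝ)) (h0E : (0 : Matrix (Fin m) (Fin n) ℝ) ∉ E)
    (u : (Fin n → ℝ) → (Fin m → ℝ)) (C : NNReal) (hu : LipschitzWith C u)
    (hu0 : ∀ x ∉ Ω, u x = 0) (hne : u ≠ 0)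
    (hincl : ∀ᵐ x ∂(volume : Measure (Fin n → ℝ)), x ∈ Ω → jac u x ∈ E) :
    n ≤ Module.finrank ℝ (Submodule.span ℝ E) := by
  by_contra! hlt
  obtain ⟨i, hi⟩ : ∃ i, (fun x => u x i) ≠ 0 := by
    by_contra! hall
    exact hne (funext fun x => funext fun i => congrFun (hall i) x)
  let row : Matrix (Fin m) (Fin n) ℝ →ₗ[ℝ] (Fin n → ℝ) := LinearMap.proj i
  have hL : (Submodule.span ℝ E).map row < ⊤ := by
    refine lt_top_iff_ne_top.mpr fun htop => ?_
    have hle := Submodule.finrank_map_le row (Submodule.span ℝ E)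
    rw [htop, finrank_top, Module.finrank_fin_fun] at hle
    omega
  obtain ⟨φ, hφ0, hφ⟩ := Submodule.exists_le_ker_of_lt_top _ hL
  let v : Fin n → ℝ := fun j => φ (Pi.single j 1)
  have hsingle : ∀ j : Fin n, (fun k => if j = k then (1 : ℝ) else 0) = Pi.single j 1 :=
    fun j => by ext k; simp [Pi.single_apply, eq_comm]
  have hφv : ∀ y, φ y = ∑ j, y j * v j := fun y => by
    simpa [v, hsingle] using LinearMap.pi_apply_eq_sum_univ φ y
  have hvv : φ v ≠ 0 := by
    intro h0
    rw [hφv] at h0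
    have hv : ∀ j, v j = 0 := fun j => mul_self_eq_zero.mp
      ((Finset.sum_eq_zero_iff_of_nonneg fun j _ => mul_self_nonneg (v j)).mp h0 j
        (Finset.mem_univ j))
    exact hφ0 (LinearMap.ext fun y => by simp [hφv, hv])
  have hui : LipschitzWith C (fun x => u x i) := by
    simpa [Function.comp_def] using (LipschitzWith.eval (α := fun _ : Fin m => ℝ) i).comp hu
  have hc : HasCompactSupport (fun x => u x i) := by
    refine HasCompactSupport.of_support_subset_isCompact hΩb.isCompact_closure fun x hx => ?_
    refine subset_closure (by_contra fun hxΩ => hx ?_)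
    simp [hu0 x hxΩ]
  refine hi (hui.eq_zero_of_fderiv_ae_eq_zero hc (LinearMap.toContinuousLinearMap φ) hvv ?_)
  filter_upwards [hincl, hu.ae_differentiableAt (μ := volume)] with x hx hd hne0
  have hxΩ : x ∈ Ω := by_contra fun hxΩ => hne0 (by simp [hu0 x hxΩ])
  have hker : φ (jac u x i) = 0 :=
    hφ (Submodule.mem_map_of_mem (f := row) (Submodule.subset_span (hx hxΩ)))
  have hfd : fderiv ℝ (fun x => u x i) x v = fderiv ℝ u x v i := by
    rw [fderiv_apply hd i]
    rfl
  have hsum := congrFun (LinearMap.pi_apply_eq_sum_univ (fderiv ℝ u x).toLinearMap v) i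
  rw [hfd, ← hker, hφv]
  simpa [jac, hsingle, mul_comm] using hsum
end
end

section
/- Let E ⊆ R^{m×n}\{0} with dim span E = n, and suppose there exists u ∈ W_0^{1,∞}(Ω; R^m), not identically zero, on an open bounded set Ω ⊆ R^n with Du ∈ E a.e. Then there exists b ∈ R^m \ {0} such that span E = b ⊗ R^n. -/
noncomputable section
open Matrix MeasureTheory

open Metric Filter Topology

/-- The derivative of a Lipschitz function vanishes almost everywhere on its zero set. -/
theorem LipschitzWith.ae_fderiv_eq_zero_of_eq_zero {V : Type*} [NormedAddCommGroup V]
    [NormedSpace ℝ V] [FiniteDimensional ℝ V] [MeasurableSpace V] [BorelSpace V]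
    {μ : Measure V} [μ.IsAddHaarMeasure] {C : NNReal} {f : V → ℝ} (hf : LipschitzWith C f) :
    ∀ᵐ x ∂μ, f x = 0 → fderiv ℝ f x = 0 := by
  rcases subsingleton_or_nontrivial V with hV | hV
  · exact .of_forall fun x _ => Subsingleton.elim _ _
  obtain ⟨v, hv⟩ := exists_ne (0 : V)
  set s : Set V := {x | f x = 0} ∩ {x | DifferentiableAt ℝ f x} with hs
  have hsm : MeasurableSet s :=
    (isClosed_eq hf.continuous continuous_const).measurableSet.inter
      (measurableSet_of_differentiableAt ℝ f)
  have happ : ApproximatesLinearOn (fun x => f x • v) (0 : V →L[ℝ] V) s 0 := by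
    intro x hx y hy
    have hx0 : f x = 0 := hx.1
    have hy0 : f y = 0 := hy.1
    simp [hx0, hy0]
  have key := happ.norm_fderiv_sub_le μ hsm (fun x => (fderiv ℝ f x).smulRight v)
    fun x hx => (hx.2.hasFDerivAt.smul_const v).hasFDerivWithinAt
  rw [ae_restrict_iff' hsm] at key
  filter_upwards [key, hf.ae_differentiableAt (μ := μ)] with x hx hd h0
  simpa [hv] using hx ⟨h0, hd⟩

section Exponential

variable {V : Type*} [NormedAddCommGroup V] [NormedSpace ℝ V]
  [MeasurableSpace V] [BorelSpace V] {μ : Measure V} [μ.IsAddHaarMeasure]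

/-- Integration by parts of a compactly supported Lipschitz function against an exponential. -/
theorem LipschitzWith.integral_fderiv_mul_exp [FiniteDimensional ℝ V] {C : NNReal} {f : V → ℝ}
    (hf : LipschitzWith C f) (hc : HasCompactSupport f)
    (w : V →L[ℝ] ℝ) (v : V) :
    Integrable (fun x => fderiv ℝ f x v * Real.exp (w x)) μ ∧
      ∫ x, fderiv ℝ f x v * Real.exp (w x) ∂μ = -(w v * ∫ x, f x * Real.exp (w x) ∂μ) := by
  obtain ⟨R, hR0, hR⟩ : ∃ R : ℝ, 0 < R ∧ tsupport f ⊆ ball 0 R := by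
    obtain ⟨R, hR⟩ := hc.isCompact.isBounded.subset_ball (0 : V)
    exact ⟨max R 1, by positivity, hR.trans (ball_subset_ball (le_max_left _ _))⟩
  let χ : ContDiffBump (0 : V) := ⟨R, R + 1, hR0, by linarith⟩
  set g : V → ℝ := fun x => χ x * Real.exp (w x) with hg
  have hgc : HasCompactSupport g := χ.hasCompactSupport.mul_right
  have hgs : ContDiff ℝ 1 g := χ.contDiff.mul w.contDiff.exp
  obtain ⟨D, hD⟩ := hgs.lipschitzWith_of_hasCompactSupport hgc (by simp)
  have hgloc : ∀ x ∈ tsupport f, g =ᶠ[𝓝 x] fun x => Real.exp (w x) := by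
    intro x hx
    filter_upwards [χ.eventuallyEq_one_of_mem_ball (hR hx)] with y hy
    simp [hg, hy]
  have h1 : (fun x => fderiv ℝ f x v * Real.exp (w x)) = fun x => fderiv ℝ f x v * g x := by
    ext x
    by_cases hx : x ∈ tsupport f
    · rw [(hgloc x hx).eq_of_nhds]
    · have : fderiv ℝ f x = 0 := by
        by_contra h
        exact hx (support_fderiv_subset ℝ h)
      simp [this]
  have h2 : ∀ x, lineDeriv ℝ g x (-v) * f x = -(w v) * (f x * Real.exp (w x)) := by
    intro x
    by_cases hx : x ∈ tsupport f
    · rw [((hgs.differentiable (by simp)) x).lineDeriv_eq_fderiv, (hgloc x hx).fderiv_eq,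
        (w.hasFDerivAt.exp).fderiv]
      simp
      ring
    · simp [image_eq_zero_of_notMem_tsupport hx]
  rw [h1]
  constructor
  · refine (hgs.continuous.integrable_of_hasCompactSupport hgc).bdd_mul (c := C * ‖v‖)
      (measurable_fderiv_apply_const ℝ f v).aestronglyMeasurable (.of_forall fun x => ?_)
    exact (ContinuousLinearMap.le_opNorm _ _).trans
      (mul_le_mul_of_nonneg_right (norm_fderiv_le_of_lipschitz ℝ hf) (norm_nonneg _))
  · have h3 := hf.integral_lineDeriv_mul_eq (μ := μ) hD hgc v
    simp_rw [h2] at h3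
    rw [integral_const_mul] at h3
    rw [← neg_mul, ← h3]
    refine integral_congr_ae ?_
    filter_upwards [hf.ae_differentiableAt (μ := μ)] with x hx
    rw [hx.lineDeriv_eq_fderiv]

/-- A compactly supported continuous function whose Laplace transform vanishes on an open cone
of directions is zero. -/
theorem eq_zero_of_integral_mul_exp_eq_zero {f : V → ℝ} (hf : Continuous f)
    (hc : HasCompactSupport f) (w : V →L[ℝ] ℝ) {r : ℝ} (hr : 0 < r)
    (h : ∀ w' ∈ closedBall w r, ∀ t : ℝ, 0 < t →
      ∫ x, f x * Real.exp ((t • w') x) ∂μ = 0) : f = 0 := by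
  have hK : IsCompact (tsupport f) := hc
  have : CompactSpace (tsupport f) := isCompact_iff_compactSpace.mp hK
  let e : (V →L[ℝ] ℝ) → C(tsupport f, ℝ) := fun z => ⟨fun x => Real.exp (z x), by fun_prop⟩
  let P : AddSubmonoid (V →L[ℝ] ℝ) :=
    { carrier := {z | ∃ t : ℝ, 0 ≤ t ∧ ‖z - t • w‖ ≤ t * r}
      zero_mem' := ⟨0, le_rfl, by simp⟩
      add_mem' := by
        rintro a b ⟨s, hs, ha⟩ ⟨t, ht, hb⟩
        refine ⟨s + t, by positivity, ?_⟩
        have : a + b - (s + t) • w = (a - s • w) + (b - t • w) := by rw [add_smul]; abel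
        rw [this]
        linarith [norm_add_le (a - s • w) (b - t • w)] }
  have hP : ∀ z ∈ P, ∫ x, f x * Real.exp (w x) * Real.exp (z x) ∂μ = 0 := by
    rintro z ⟨t, ht, hz⟩
    have h1 : 0 < 1 + t := by linarith
    have := h ((1 + t)⁻¹ • (w + z)) ?_ (1 + t) h1
    · rw [smul_inv_smul₀ h1.ne'] at this
      rw [← this]
      congr 1 with x
      simp [Real.exp_add, mul_assoc]
    · rw [mem_closedBall, dist_eq_norm]
      have h2 : (1 + t)⁻¹ • (w + z) - w = (1 + t)⁻¹ • (z - t • w) := by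
        rw [eq_inv_smul_iff₀ h1.ne', smul_sub, smul_inv_smul₀ h1.ne', add_smul, one_smul]
        abel
      rw [h2, norm_smul, norm_inv, Real.norm_of_nonneg h1.le, inv_mul_le_iff₀ h1]
      nlinarith
  let M : Submonoid C(tsupport f, ℝ) :=
    { carrier := e '' P
      one_mem' := ⟨0, P.zero_mem, by ext; simp [e]⟩
      mul_mem' := by
        rintro _ _ ⟨a, ha, rfl⟩ ⟨b, hb, rfl⟩
        exact ⟨a + b, P.add_mem ha hb, by ext; simp [e, Real.exp_add]⟩ }
  have hsep : (Algebra.adjoin ℝ (M : Set C(tsupport f, ℝ))).SeparatesPoints := by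
    intro x y hxy
    by_contra! hcon
    have heq : ∀ z ∈ P, z (x : V) = z y := by
      intro z hz
      have := hcon (e z) ⟨e z, Algebra.subset_adjoin ⟨z, hz, rfl⟩, rfl⟩
      exact Real.exp_injective this
    obtain ⟨g, hg⟩ := SeparatingDual.exists_separating_of_ne (R := ℝ)
      (fun hh => hxy (Subtype.ext hh) : (x : V) ≠ y)
    have hw := heq w ⟨1, zero_le_one, by simp [hr.le]⟩
    have hc0 : 0 < r / (‖g‖ + 1) := by positivity
    have hwg := heq (w + (r / (‖g‖ + 1)) • g) ⟨1, zero_le_one, by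
      rw [one_smul, add_sub_cancel_left, norm_smul, Real.norm_of_nonneg hc0.le, one_mul,
        div_mul_eq_mul_div, div_le_iff₀ (by positivity)]
      nlinarith [norm_nonneg g]⟩
    simp only [_root_.add_apply, _root_.smul_apply, hw,
      smul_eq_mul, add_right_inj] at hwg
    exact hg (mul_left_cancel₀ hc0.ne' hwg)
  set ν : V → ℝ := fun x => f x * Real.exp (w x) with hν
  have hνc : Continuous ν := by fun_prop
  have hνcs : HasCompactSupport ν := hc.mul_right
  have hνK : ∀ x ∉ tsupport f, ν x = 0 := fun x hx => by
    simp [hν, image_eq_zero_of_notMem_tsupport hx]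
  have hset : ∀ q : V → ℝ, ∫ x, ν x * q x ∂μ = ∫ x : tsupport f, ν x * q x ∂μ.comap (↑) := by
    intro q
    rw [integral_subtype_comap hK.measurableSet (fun x => ν x * q x)]
    exact (setIntegral_eq_integral_of_forall_compl_eq_zero fun x hx => by simp [hνK x hx]).symm
  set μK : Measure (tsupport f) := μ.comap (↑) with hμK
  have : IsFiniteMeasure μK := by
    constructor
    rw [hμK, (MeasurableEmbedding.subtype_coe hK.measurableSet).comap_apply]
    simpa using hK.measure_lt_top
  have hint : ∀ q : C(tsupport f, ℝ), Integrable (fun x : tsupport f => ν x * q x) μK := by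
    intro q
    have hcont : Continuous fun x : tsupport f => ν x * q x := by fun_prop
    exact hcont.integrable_of_hasCompactSupport (HasCompactSupport.of_compactSpace _)
  let Λ : C(tsupport f, ℝ) →ₗ[ℝ] ℝ :=
    { toFun := fun q => ∫ x, ν x * q x ∂μK
      map_add' := fun p q => by
        simp only [ContinuousMap.add_apply, mul_add]
        exact integral_add (hint p) (hint q)
      map_smul' := fun c q => by
        simp only [ContinuousMap.smul_apply, smul_eq_mul, RingHom.id_apply]
        rw [← integral_const_mul]
        congr 1 with x
        ring }
  have hΛ : Continuous Λ := by
    refine AddMonoidHomClass.continuous_of_bound Λ (∫ x, ‖ν x‖ ∂μK) fun q => ?_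
    rw [← integral_mul_const]
    have hν' : Integrable (fun x : tsupport f => ν x) μK := by simpa using hint 1
    refine norm_integral_le_of_norm_le (hν'.norm.mul_const ‖q‖) (.of_forall fun x => ?_)
    rw [norm_mul]
    exact mul_le_mul_of_nonneg_left (q.norm_coe_le_norm x) (norm_nonneg _)
  have hker : ∀ q, Λ q = 0 := by
    have hle : Subalgebra.toSubmodule (Algebra.adjoin ℝ (M : Set C(tsupport f, ℝ))) ≤
        LinearMap.ker Λ := by
      rw [Algebra.adjoin_eq_span, Submonoid.closure_eq, Submodule.span_le]
      rintro _ ⟨z, hz, rfl⟩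
      exact (hset fun x => Real.exp (z x)).symm.trans (hP z hz)
    intro q
    have hq : q ∈ (Algebra.adjoin ℝ (M : Set C(tsupport f, ℝ))).topologicalClosure := by
      rw [ContinuousMap.subalgebra_topologicalClosure_eq_top_of_separatesPoints _ hsep]
      trivial
    exact closure_minimal (fun p hp => hle hp) (isClosed_singleton.preimage hΛ) hq
  have hzero : ∫ x, ν x * ν x ∂μ = 0 := (hset ν).trans (hker ⟨fun x => ν x, by fun_prop⟩)
  by_contra hne
  obtain ⟨x, hx⟩ := Function.ne_iff.mp hne
  have hpos := (hνc.mul hνc).integral_pos_of_hasCompactSupport_nonneg_nonzero (μ := μ)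
    (hνcs.mul_right) (fun x => mul_self_nonneg (ν x)) (x := x)
    (by simpa [hν] using hx)
  exact hpos.ne' hzero

end Exponential

/-- If the Jacobian of a compactly supported Lipschitz map lies a.e. in a linear space of
matrices, then so do the products of the values of its Laplace transform with the frequency. -/
theorem vecMulVec_integral_mul_exp_mem {m n : ℕ} (L : Submodule ℝ (Matrix (Fin m) (Fin n) ℝ))
    {u : (Fin n → ℝ) → (Fin m → ℝ)} {C : NNReal} (hu : LipschitzWith C u)
    (hc : HasCompactSupport u) (hL : ∀ᵐ x, jac u x ∈ L) (w : (Fin n → ℝ) →L[ℝ] ℝ) :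
    vecMulVec (fun i => ∫ x, u x i * Real.exp (w x)) (fun j => w (Pi.single j 1)) ∈ L := by
  by_contra hmem
  obtain ⟨φ, hφ, hLφ⟩ := Submodule.exists_le_ker_of_notMem hmem
  have hexp : ∀ A, φ A = ∑ i, ∑ j, φ (Matrix.single i j 1) * A i j := by
    intro A
    conv_lhs => rw [matrix_eq_sum_single A]
    simp only [map_sum]
    refine Finset.sum_congr rfl fun i _ => Finset.sum_congr rfl fun j _ => ?_
    rw [← mul_one (A i j), ← smul_eq_mul, ← Matrix.smul_single, map_smul]
    simp [mul_comm]
  have hui : ∀ i, LipschitzWith C fun x => u x i := fun i => by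
    simpa [Function.comp_def] using (LipschitzWith.eval (α := fun _ : Fin m => ℝ) i).comp hu
  have hci : ∀ i, HasCompactSupport fun x => u x i := fun i =>
    hc.comp_left (g := fun y : Fin m → ℝ => y i) rfl
  have hparts := fun i j =>
    (hui i).integral_fderiv_mul_exp (μ := volume) (hci i) w (Pi.single j 1)
  have h0 : ∫ x, ∑ i, ∑ j, φ (Matrix.single i j 1) *
      (fderiv ℝ (fun y => u y i) x (Pi.single j 1) * Real.exp (w x)) = 0 := by
    rw [← integral_zero (Fin n → ℝ) ℝ (μ := volume)]
    refine integral_congr_ae ?_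
    filter_upwards [hL, hu.ae_differentiableAt (μ := volume)] with x hx hd
    have h1 : φ (jac u x) = 0 := hLφ hx
    rw [hexp] at h1
    have h2 : ∀ i j, jac u x i j = fderiv ℝ (fun y => u y i) x (Pi.single j 1) := fun i j => by
      rw [fderiv_apply hd]
      rfl
    simp only [h2] at h1
    simp only [← mul_assoc, ← Finset.sum_mul, h1, zero_mul]
  rw [integral_finsetSum _ fun i _ =>
    integrable_finsetSum _ fun j _ => (hparts i j).1.const_mul _] at h0
  simp_rw [integral_finsetSum Finset.univ fun j _ => (hparts _ j).1.const_mul _,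
    integral_const_mul, (hparts _ _).2] at h0
  apply hφ
  rw [hexp, ← neg_eq_zero, ← h0]
  simp only [vecMulVec_apply, mul_neg, Finset.sum_neg_distrib, mul_comm (w _)]

/-- The frequencies `w` such that `L` contains a matrix `a ⊗ w` with `a ≠ 0` form a closed set. -/
theorem isClosed_setOf_exists_vecMulVec_mem {m n : ℕ}
    (L : Submodule ℝ (Matrix (Fin m) (Fin n) ℝ)) :
    IsClosed {w : (Fin n → ℝ) →L[ℝ] ℝ | ∃ a : Fin m → ℝ, a ≠ 0 ∧
      vecMulVec a (fun j => w (Pi.single j 1)) ∈ L} := by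
  have hcl : IsClosed {p : sphere (0 : Fin m → ℝ) 1 × ((Fin n → ℝ) →L[ℝ] ℝ) |
      vecMulVec (p.1 : Fin m → ℝ) (fun j => p.2 (Pi.single j 1)) ∈ L} := by
    refine L.closed_of_finiteDimensional.preimage ?_
    refine continuous_matrix fun i j => ?_
    simp only [vecMulVec_apply]
    exact ((continuous_apply i).comp (continuous_subtype_val.comp continuous_fst)).mul
      ((ContinuousLinearMap.apply ℝ ℝ (Pi.single j (1 : ℝ) : Fin n → ℝ)).continuous.comp continuous_snd)
  convert isClosedMap_snd_of_compactSpace _ hcl using 1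
  ext w
  constructor
  · rintro ⟨a, ha, haL⟩
    refine ⟨(⟨‖a‖⁻¹ • a, by simp [norm_smul, ha]⟩, w), ?_, rfl⟩
    simpa only [Set.mem_ofPred_eq, smul_vecMulVec] using L.smul_mem ‖a‖⁻¹ haL
  · rintro ⟨⟨a, w⟩, hp, rfl⟩
    exact ⟨a, ne_zero_of_mem_unit_sphere a, hp⟩

/-- An `n`-dimensional space of `m × n` matrices which contains, for every `x`, some `a ⊗ x` with
`a ≠ 0` has the form `b ⊗ ℝⁿ`. -/
theorem exists_eq_vecMulVec_of_finrank_eq {m n : ℕ} (L : Submodule ℝ (Matrix (Fin m) (Fin n) ℝ))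
    (hdim : Module.finrank ℝ L = n)
    (h : ∀ x : Fin n → ℝ, ∃ a : Fin m → ℝ, a ≠ 0 ∧ vecMulVec a x ∈ L) :
    ∃ b : Fin m → ℝ, b ≠ 0 ∧
      (L : Set (Matrix (Fin m) (Fin n) ℝ)) = {M | ∃ x : Fin n → ℝ, M = vecMulVec b x} := by
  choose a ha haL using fun j : Fin n => h (Pi.single j 1)
  obtain ⟨b, hb, hbL⟩ := h 1
  have hsum : ∀ (c : Fin n → ℝ) i k,
      (∑ j, c j • vecMulVec (a j) (Pi.single j (1 : ℝ))) i k = c k * a k i := by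
    intro c i k
    simp [Matrix.sum_apply, vecMulVec_apply, Pi.single_apply]
  have hli : LinearIndependent ℝ fun j => vecMulVec (a j) (Pi.single j (1 : ℝ)) := by
    rw [Fintype.linearIndependent_iff]
    intro c hc k
    obtain ⟨i, hi⟩ := Function.ne_iff.mp (ha k)
    have := hsum c i k
    rw [hc] at this
    exact (mul_eq_zero.mp this.symm).resolve_right hi
  have hspan : Submodule.span ℝ (Set.range fun j => vecMulVec (a j) (Pi.single j (1 : ℝ))) = L := by
    refine Submodule.eq_of_le_of_finrank_eq ?_ ?_
    · rw [Submodule.span_le]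
      rintro _ ⟨j, rfl⟩
      exact haL j
    · rw [finrank_span_eq_card hli, hdim, Fintype.card_fin]
  rw [← hspan, Submodule.mem_span_range_iff_exists_fun] at hbL
  obtain ⟨c, hc⟩ := hbL
  have hbc : ∀ k, b = c k • a k := fun k => by
    ext i
    have := hsum c i k
    rw [hc] at this
    simpa [vecMulVec_apply] using this
  let T : (Fin n → ℝ) →ₗ[ℝ] Matrix (Fin m) (Fin n) ℝ := vecMulVecBilin ℝ ℝ b
  have hT : ∀ x, T x = vecMulVec b x := fun x => rfl
  have hinj : Function.Injective T := by
    rw [← LinearMap.ker_eq_bot, LinearMap.ker_eq_bot']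
    intro x hx
    obtain ⟨i, hi⟩ := Function.ne_iff.mp hb
    ext k
    have := congrFun (congrFun hx i) k
    exact (mul_eq_zero.mp this).resolve_left hi
  have hrange : LinearMap.range T = L := by
    refine Submodule.eq_of_le_of_finrank_eq ?_ ?_
    · rintro _ ⟨x, rfl⟩
      rw [pi_eq_sum_univ' x, map_sum]
      refine L.sum_mem fun k _ => ?_
      rw [map_smul]
      refine L.smul_mem _ ?_
      rw [hT, hbc k, smul_vecMulVec]
      exact L.smul_mem _ (by convert haL k using 2)
    · rw [LinearMap.finrank_range_of_inj hinj, hdim, Module.finrank_fin_fun]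
  refine ⟨b, hb, ?_⟩
  rw [← hrange]
  ext A
  simp [hT, eq_comm]

/-- If `E ⊆ ℝ^{m×n} \ {0}` with `dim span E = n` and there is a not
identically zero `u ∈ W₀^{1,∞}(Ω; ℝᵐ)` with `Du ∈ E` a.e. in the open bounded set `Ω`,
then `span E = b ⊗ ℝⁿ` for some nonzero `b ∈ ℝᵐ`. -/
theorem stmt7 {m n : ℕ} (Ω : Set (Fin n → ℝ)) (hΩo : IsOpen Ω) (hΩb : Bornology.IsBounded Ω)
    (E : Set (Matrix (Fin m) (Fin n) ℝ)) (h0E : (0 : Matrix (Fin m) (Fin n) ℝ) ∉ E)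
    (hdim : Module.finrank ℝ (Submodule.span ℝ E) = n)
    (u : (Fin n → ℝ) → (Fin m → ℝ)) (C : NNReal) (hu : LipschitzWith C u)
    (hu0 : ∀ x ∉ Ω, u x = 0) (hne : u ≠ 0)
    (hincl : ∀ᵐ x ∂(volume : Measure (Fin n → ℝ)), x ∈ Ω → jac u x ∈ E) :
    ∃ b : Fin m → ℝ, b ≠ 0 ∧
      (Submodule.span ℝ E : Set (Matrix (Fin m) (Fin n) ℝ)) =
        {M | ∃ x : Fin n → ℝ, M = vecMulVec b x} := by
  set L := Submodule.span ℝ E with hLdef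
  have hc : HasCompactSupport u :=
    HasCompactSupport.intro hΩb.isCompact_closure fun x hx =>
      hu0 x fun hxΩ => hx (subset_closure hxΩ)
  have hui : ∀ i, LipschitzWith C fun x => u x i := fun i => by
    simpa [Function.comp_def] using (LipschitzWith.eval (α := fun _ : Fin m => ℝ) i).comp hu
  have hL : ∀ᵐ x, jac u x ∈ L := by
    filter_upwards [hincl, hu.ae_differentiableAt (μ := volume),
      ae_all_iff.mpr fun i => (hui i).ae_fderiv_eq_zero_of_eq_zero (μ := volume)] with x hx hd hz
    by_cases hxΩ : x ∈ Ω
    · exact Submodule.subset_span (hx hxΩ)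
    · have : jac u x = 0 := by
        ext i j
        have := congrArg (fun T : (Fin n → ℝ) →L[ℝ] ℝ => T (Pi.single j 1))
          (hz i (congrFun (hu0 x hxΩ) i))
        rw [fderiv_apply hd] at this
        exact this
      rw [this]
      exact L.zero_mem
  refine exists_eq_vecMulVec_of_finrank_eq L hdim fun y => ?_
  have hall : ∀ w : (Fin n → ℝ) →L[ℝ] ℝ, ∃ a : Fin m → ℝ, a ≠ 0 ∧
      vecMulVec a (fun j => w (Pi.single j 1)) ∈ L := by
    intro w
    by_contra hw
    obtain ⟨r, hr, hball⟩ := Metric.nhds_basis_closedBall.mem_iff.mp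
      ((isClosed_setOf_exists_vecMulVec_mem L).isOpen_compl.mem_nhds hw)
    refine hne (funext fun x => funext fun i => ?_)
    refine congrFun (eq_zero_of_integral_mul_exp_eq_zero (μ := volume) (hui i).continuous
      (hc.comp_left (g := fun y : Fin m → ℝ => y i) rfl) w hr fun w' hw' t ht => ?_) x
    have hmem := vecMulVec_integral_mul_exp_mem L hu hc hL (t • w')
    by_contra hnz
    refine hball hw' ⟨fun i => ∫ x, u x i * Real.exp ((t • w') x),
      fun h0 => hnz (congrFun h0 i), ?_⟩
    have h2 := L.smul_mem t⁻¹ hmem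
    rw [← vecMulVec_smul] at h2
    convert h2 using 2
    ext j
    simp [ht.ne']
  obtain ⟨a, ha, haL⟩ := hall (∑ j, y j • ContinuousLinearMap.proj j)
  refine ⟨a, ha, ?_⟩
  convert haL using 2
  ext j
  simp [Pi.single_apply]
end
end

section
/- Let Ω ⊆ R^n be open and bounded, E ⊆ R^{m×n} with 0 ∉ E and dim span E = n. There exists u ∈ W_0^{1,∞}(Ω; R^m) with Du ∈ E a.e. in Ω if and only if 0 ∈ ri(co E) and span E = b ⊗ R^n for some nonzero b ∈ R^m. -/
noncomputable section
open Matrix MeasureTheory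

/-- If `0` lies in the interior of the convex hull of `E`, then finitely many elements of `E`
have the property that every nonzero vector makes a uniformly negative product with one of them. -/
theorem exists_finset_dotProduct_le_neg {ι : Type*} [Fintype ι] {E : Set (ι → ℝ)}
    (h : (0 : ι → ℝ) ∈ interior (convexHull ℝ E)) :
    ∃ (t : Finset (ι → ℝ)) (ε : ℝ), ↑t ⊆ E ∧ 0 < ε ∧ ∀ x, ∃ e ∈ t, e ⬝ᵥ x ≤ -ε * ‖x‖ := by
  classical
  obtain ⟨ε, hε, hball⟩ := Metric.nhds_basis_closedBall.mem_iff.1 (mem_interior_iff_mem_nhds.1 h)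
  have hfin : ∀ y ∈ convexHull ℝ E, ∃ t : Finset (ι → ℝ), ↑t ⊆ E ∧
      y ∈ convexHull ℝ (t : Set (ι → ℝ)) := by
    intro y hy
    rw [convexHull_eq_union_convexHull_finite_subsets] at hy
    simpa using hy
  have hmem : ∀ (σ : Bool) (j : ι), Pi.single j (if σ then ε else -ε) ∈ convexHull ℝ E := by
    intro σ j
    apply hball
    rw [mem_closedBall_zero_iff, Pi.norm_single]
    split_ifs <;> simp [abs_of_pos hε]
  choose s hsE hs using fun σ j => hfin _ (hmem σ j)
  obtain ⟨s₀, hs₀E, hs₀⟩ := hfin 0 (interior_subset h)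
  refine ⟨s₀ ∪ Finset.univ.biUnion fun p : Bool × ι => s p.1 p.2, ε, ?_, hε, ?_⟩
  · intro e he
    simp only [Finset.coe_union, Finset.coe_biUnion, Set.mem_union, Set.mem_iUnion,
      Finset.mem_coe] at he
    rcases he with he | ⟨p, -, he⟩
    · exact hs₀E he
    · exact hsE _ _ he
  have key : ∀ (t : Finset (ι → ℝ)) (p x : ι → ℝ), p ∈ convexHull ℝ (t : Set (ι → ℝ)) →
      ∃ e ∈ t, e ⬝ᵥ x ≤ p ⬝ᵥ x := by
    intro t p x hp
    by_contra! hcon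
    have hconv : Convex ℝ {y : ι → ℝ | p ⬝ᵥ x < y ⬝ᵥ x} :=
      convex_halfSpace_gt (f := fun y : ι → ℝ => y ⬝ᵥ x)
        ⟨fun a b => add_dotProduct a b x, fun c a => smul_dotProduct c a x⟩ _
    have hlt : p ∈ {y : ι → ℝ | p ⬝ᵥ x < y ⬝ᵥ x} :=
      convexHull_min (fun e he => hcon e he) hconv hp
    exact absurd (show p ⬝ᵥ x < p ⬝ᵥ x from hlt) (lt_irrefl _)
  intro x
  by_cases hx : x = 0
  · obtain ⟨e, he, hle⟩ := key _ _ x hs₀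
    exact ⟨e, Finset.mem_union_left _ he, by simp [hx]⟩
  have : Nonempty ι := by
    by_contra hne
    rw [not_nonempty_iff] at hne
    exact hx (Subsingleton.elim _ _)
  obtain ⟨j, hj⟩ : ∃ j, ‖x‖ = |x j| := by
    obtain ⟨j, -, hj⟩ := Finset.exists_max_image Finset.univ (fun j => ‖x j‖) Finset.univ_nonempty
    refine ⟨j, le_antisymm ?_ (norm_le_pi_norm x j)⟩
    exact (pi_norm_le_iff_of_nonneg (abs_nonneg _)).2 fun i => hj i (Finset.mem_univ _)
  obtain ⟨e, he, hle⟩ := key _ _ x (hs (decide (x j < 0)) j)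
  refine ⟨e, Finset.mem_union_right _ (Finset.mem_biUnion.2 ⟨(_, j), Finset.mem_univ _, he⟩), ?_⟩
  refine hle.trans ?_
  rw [single_dotProduct, hj]
  by_cases hlt : x j < 0
  · simp [hlt, abs_of_neg hlt]
  · simp [hlt, abs_of_nonneg (not_lt.1 hlt)]

theorem abs_dotProduct_le {ι : Type*} [Fintype ι] (e x : ι → ℝ) :
    |e ⬝ᵥ x| ≤ (∑ i, |e i|) * ‖x‖ := by
  rw [dotProduct, Finset.sum_mul]
  refine (Finset.abs_sum_le_sum_abs _ _).trans (Finset.sum_le_sum fun i _ => ?_)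
  rw [abs_mul]
  exact mul_le_mul_of_nonneg_left (norm_le_pi_norm x i) (abs_nonneg _)

/-- A level set of a nonzero linear form is Lebesgue-null. -/
theorem volume_dotProduct_eq {ι : Type*} [Fintype ι] {e : ι → ℝ} (he : e ≠ 0) (c : ℝ) :
    volume {x : ι → ℝ | e ⬝ᵥ x = c} = 0 := by
  let A : AffineSubspace ℝ (ι → ℝ) :=
    { carrier := {x | e ⬝ᵥ x = c}
      smul_vsub_vadd_mem' := by
        intro r x y z hx hy hz
        simp only [Set.mem_ofPred_eq, vsub_eq_sub, vadd_eq_add, dotProduct_add, dotProduct_smul,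
          dotProduct_sub] at *
        simp [hx, hy, hz] }
  refine Measure.addHaar_affineSubspace volume A fun hA => he ?_
  have hall : ∀ x : ι → ℝ, e ⬝ᵥ x = c := fun x => by
    have : x ∈ A := hA ▸ AffineSubspace.mem_top ℝ _ x
    exact this
  have hc : c = 0 := by simpa using (hall 0).symm
  exact dotProduct_eq_zero e fun x => (hall x).trans hc

/-- Nonnegative Lipschitz functions supported in pairwise disjoint sets glue to a Lipschitz
function with the same constant. -/
theorem exists_lipschitzWith_glue {α κ : Type*} [PseudoMetricSpace α] {K : NNReal} {s : Set κ}
    {B : κ → Set α} {ψ : κ → α → ℝ} (hB : s.PairwiseDisjoint B) (hψ : ∀ k x, 0 ≤ ψ k x)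
    (hoff : ∀ k, ∀ x ∉ B k, ψ k x = 0) (hlip : ∀ k, LipschitzWith K (ψ k)) :
    ∃ w : α → ℝ, LipschitzWith K w ∧ (∀ k ∈ s, ∀ x ∈ B k, w x = ψ k x) ∧
      ∀ x ∉ ⋃ k ∈ s, B k, w x = 0 := by
  classical
  let w : α → ℝ := fun x => if h : ∃ k ∈ s, x ∈ B k then ψ h.choose x else 0
  have hw : ∀ k ∈ s, ∀ x ∈ B k, w x = ψ k x := by
    intro k hk x hx
    have h : ∃ k ∈ s, x ∈ B k := ⟨k, hk, hx⟩
    have : h.choose = k := hB.elim_set h.choose_spec.1 hk x h.choose_spec.2 hx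
    simp only [w, dif_pos h, this]
  have hw0 : ∀ x ∉ ⋃ k ∈ s, B k, w x = 0 := by
    intro x hx
    have h : ¬ ∃ k ∈ s, x ∈ B k := by simpa using hx
    simp only [w, dif_neg h]
  have hle : ∀ k ∈ s, ∀ x, ψ k x ≤ w x := by
    intro k hk x
    by_cases hx : x ∈ B k
    · exact (hw k hk x hx).ge
    · rw [hoff k x hx]
      by_cases h : ∃ k ∈ s, x ∈ B k
      · obtain ⟨l, hl, hxl⟩ := h
        exact hw l hl x hxl ▸ hψ l x
      · simp only [w, dif_neg h, le_refl]
  refine ⟨w, LipschitzWith.of_le_add_mul K fun x y => ?_, hw, hw0⟩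
  by_cases h : ∃ k ∈ s, x ∈ B k
  · obtain ⟨k, hk, hx⟩ := h
    rw [hw k hk x hx]
    have h1 := (hlip k).le_add_mul x y
    have h2 := hle k hk y
    linarith
  · have hx : w x = 0 := by simp only [w, dif_neg h]
    have hy : 0 ≤ w y := by
      by_cases h : ∃ k ∈ s, y ∈ B k
      · obtain ⟨l, hl, hyl⟩ := h
        exact hw l hl y hyl ▸ hψ l y
      · simp only [w, dif_neg h, le_refl]
    rw [hx]
    positivity

/-- The concave pyramid with apex height `p.2` over `p.1` whose faces have gradients in `t`, cut
off at height zero. -/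
def pyramid {ι : Type*} [Fintype ι] (t : Finset (ι → ℝ)) (ht : t.Nonempty) (p : (ι → ℝ) × ℝ)
    (x : ι → ℝ) : ℝ :=
  max 0 (t.inf' ht fun e => p.2 + e ⬝ᵥ (x - p.1))

/-- The base of the pyramid `pyramid t ht p`. -/
def pyramidBase {ι : Type*} [Fintype ι] (t : Finset (ι → ℝ)) (p : (ι → ℝ) × ℝ) : Set (ι → ℝ) :=
  {x | ∀ e ∈ t, 0 ≤ p.2 + e ⬝ᵥ (x - p.1)}

section Pyramid

variable {ι : Type*} [Fintype ι] {t : Finset (ι → ℝ)} {p : (ι → ℝ) × ℝ}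

theorem pyramid_nonneg (ht : t.Nonempty) (x : ι → ℝ) : 0 ≤ pyramid t ht p x :=
  le_max_left _ _

theorem pyramid_eq_zero (ht : t.Nonempty) {x : ι → ℝ} (hx : x ∉ pyramidBase t p) :
    pyramid t ht p x = 0 := by
  have : ∃ e ∈ t, p.2 + e ⬝ᵥ (x - p.1) < 0 := by
    by_contra! h
    exact hx h
  obtain ⟨e, he, hlt⟩ := this
  exact max_eq_left ((Finset.inf'_le _ he).trans hlt.le)

theorem pyramid_eq_inf' (ht : t.Nonempty) {x : ι → ℝ} (hx : x ∈ pyramidBase t p) :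
    pyramid t ht p x = t.inf' ht fun e => p.2 + e ⬝ᵥ (x - p.1) :=
  max_eq_right (Finset.le_inf' _ _ hx)

theorem lipschitzWith_pyramid (ht : t.Nonempty) {K : NNReal} (hK : ∀ e ∈ t, ∑ i, |e i| ≤ K) :
    LipschitzWith K (pyramid t ht p) := by
  refine LipschitzWith.of_le_add_mul K fun x y => max_le ?_ ?_
  · have := pyramid_nonneg (p := p) ht y
    positivity
  · obtain ⟨e, he, hy⟩ := Finset.exists_mem_eq_inf' ht fun e => p.2 + e ⬝ᵥ (y - p.1)
    have h1 : t.inf' ht (fun e => p.2 + e ⬝ᵥ (x - p.1)) ≤ p.2 + e ⬝ᵥ (x - p.1) :=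
      Finset.inf'_le _ he
    have h2 : p.2 + e ⬝ᵥ (y - p.1) ≤ pyramid t ht p y := hy ▸ le_max_right _ _
    have h3 : e ⬝ᵥ (x - p.1) = e ⬝ᵥ (y - p.1) + e ⬝ᵥ (x - y) := by
      rw [← dotProduct_add]
      congr 1
      abel
    have h4 : e ⬝ᵥ (x - y) ≤ K * dist x y := by
      rw [dist_eq_norm]
      exact (le_abs_self _).trans ((abs_dotProduct_le _ _).trans
        (mul_le_mul_of_nonneg_right (hK e he) (norm_nonneg _)))
    linarith

theorem isClosed_pyramidBase : IsClosed (pyramidBase t p) := by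
  have : pyramidBase t p = ⋂ e ∈ t, {x | 0 ≤ p.2 + e ⬝ᵥ (x - p.1)} := by
    ext x
    simp [pyramidBase]
  rw [this]
  exact isClosed_biInter fun e _ => isClosed_le continuous_const (by fun_prop)

theorem pyramidBase_subset_closedBall {ε : ℝ} (hε : 0 < ε)
    (h : ∀ x, ∃ e ∈ t, e ⬝ᵥ x ≤ -ε * ‖x‖) :
    pyramidBase t p ⊆ Metric.closedBall p.1 (p.2 / ε) := by
  intro x hx
  obtain ⟨e, he, hle⟩ := h (x - p.1)
  rw [Metric.mem_closedBall, dist_eq_norm, le_div_iff₀ hε]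
  linarith [hx e he]

theorem closedBall_subset_pyramidBase {K : ℝ} (hK0 : 0 < K) (hK : ∀ e ∈ t, ∑ i, |e i| ≤ K) :
    Metric.closedBall p.1 (p.2 / K) ⊆ pyramidBase t p := by
  intro x hx e he
  rw [Metric.mem_closedBall, dist_eq_norm, le_div_iff₀ hK0] at hx
  have h1 := neg_le_of_abs_le (abs_dotProduct_le e (x - p.1))
  have h2 := mul_le_mul_of_nonneg_right (hK e he) (norm_nonneg (x - p.1))
  linarith

/-- At points above the interior of the base, every differentiable function that agrees with the
pyramid on its base has a gradient in `t`. -/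
theorem exists_fderiv_eq_dotProduct_of_eqOn_pyramid (ht : t.Nonempty) {w : (ι → ℝ) → ℝ}
    (hw : Set.EqOn w (pyramid t ht p) (pyramidBase t p)) {x : ι → ℝ}
    (hx : ∀ e ∈ t, 0 < p.2 + e ⬝ᵥ (x - p.1)) (hd : DifferentiableAt ℝ w x) :
    ∃ e ∈ t, ∀ v, fderiv ℝ w x v = e ⬝ᵥ v := by
  obtain ⟨e, he, hxe⟩ := Finset.exists_mem_eq_inf' ht fun e => p.2 + e ⬝ᵥ (x - p.1)
  refine ⟨e, he, fun v => ?_⟩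
  let ℓ : (ι → ℝ) →L[ℝ] ℝ := ∑ i, e i • ContinuousLinearMap.proj i
  have hℓ : ∀ y, ℓ y = e ⬝ᵥ y := fun y => by simp [ℓ, dotProduct]
  have hmem : ∀ᶠ y in nhds x, y ∈ pyramidBase t p := by
    have : ∀ᶠ y in nhds x, ∀ e ∈ t, 0 < p.2 + e ⬝ᵥ (y - p.1) := by
      rw [Filter.eventually_all_finset]
      intro e he
      have hc : Continuous fun y => p.2 + e ⬝ᵥ (y - p.1) := by fun_prop
      exact hc.continuousAt.eventually_const_lt (hx e he)
    filter_upwards [this] with y hy e he using (hy e he).le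
  have hmin : IsLocalMin (fun y => ℓ y - w y) x := by
    filter_upwards [hmem] with y hy
    have hxb : x ∈ pyramidBase t p := fun e he => (hx e he).le
    rw [hw hy, hw hxb, pyramid_eq_inf' ht hy, pyramid_eq_inf' ht hxb, hxe, hℓ, hℓ]
    have := Finset.inf'_le (fun e => p.2 + e ⬝ᵥ (y - p.1)) he
    simp only [dotProduct_sub] at this ⊢
    linarith
  have hfd := hmin.fderiv_eq_zero
  rw [fderiv_fun_sub ℓ.differentiableAt hd, ContinuousLinearMap.fderiv, sub_eq_zero] at hfd
  rw [← hfd, hℓ]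

end Pyramid

/-- If `0` lies in the interior of the convex hull of `E` but not in `E`, then the inclusion
`∇w ∈ E` has a Lipschitz solution vanishing outside the open set `Ω`. -/
theorem exists_lipschitzWith_gradient_mem {ι : Type*} [Fintype ι] {Ω E : Set (ι → ℝ)}
    (hΩ : IsOpen Ω) (h0 : (0 : ι → ℝ) ∉ E) (h : (0 : ι → ℝ) ∈ interior (convexHull ℝ E)) :
    ∃ (w : (ι → ℝ) → ℝ) (K : NNReal), LipschitzWith K w ∧ (∀ x ∉ Ω, w x = 0) ∧
      ∀ᵐ x, x ∈ Ω → DifferentiableAt ℝ w x ∧ ∃ e ∈ E, ∀ v, fderiv ℝ w x v = e ⬝ᵥ v := by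
  obtain ⟨t, ε, htE, hε, hneg⟩ := exists_finset_dotProduct_le_neg h
  have ht : t.Nonempty := let ⟨e, he, _⟩ := hneg 0; ⟨e, he⟩
  obtain ⟨K, hK0, hK⟩ : ∃ K : NNReal, 0 < (K : ℝ) ∧ ∀ e ∈ t, ∑ i, |e i| ≤ K := by
    refine ⟨1 + ∑ e ∈ t, ∑ i, ‖e i‖₊, by positivity, fun e he => ?_⟩
    have := Finset.single_le_sum (f := fun e : ι → ℝ => ∑ i, |e i|)
      (fun e _ => Finset.sum_nonneg fun i _ => abs_nonneg (e i)) he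
    push_cast
    simp only [Real.norm_eq_abs]
    linarith
  let T : Set ((ι → ℝ) × ℝ) := {p | 0 < p.2 ∧ Metric.closedBall p.1 (p.2 / ε) ⊆ Ω}
  obtain ⟨s, hsT, hsc, hdisj, hcov⟩ := Vitali.exists_disjoint_covering_ae volume Ω T
    (Real.toNNReal ((3 * K / ε) ^ Fintype.card ι)) (fun p => p.2 / ε) Prod.fst (pyramidBase t)
    (fun p _ => pyramidBase_subset_closedBall hε hneg)
    (by
      intro p hp
      have hp0 : 0 < p.2 := hp.1
      refine le_trans ?_ (mul_le_mul_right (measure_mono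
        (closedBall_subset_pyramidBase (t := t) (p := p) hK0 hK)) _)
      rw [Real.volume_pi_closedBall _ (by positivity), Real.volume_pi_closedBall _ (by positivity),
        ENNReal.ofNNReal_toNNReal, ← ENNReal.ofReal_mul (by positivity), ← mul_pow]
      refine (congrArg (fun z : ℝ => ENNReal.ofReal (z ^ Fintype.card ι)) ?_).le
      field_simp)
    (fun p hp => (Metric.nonempty_ball.2 (div_pos hp.1 hK0)).mono
      (interior_maximal (Metric.ball_subset_closedBall.trans
        (closedBall_subset_pyramidBase hK0 hK)) Metric.isOpen_ball))
    (fun p _ => isClosed_pyramidBase)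
    (by
      intro x hx δ hδ
      obtain ⟨r, hr, hsub⟩ := Metric.nhds_basis_closedBall.mem_iff.1 (hΩ.mem_nhds hx)
      refine ⟨(x, ε * min r δ), ⟨by positivity, ?_⟩, ?_, rfl⟩
      · rw [mul_div_cancel_left₀ _ hε.ne']
        exact (Metric.closedBall_subset_closedBall (min_le_left _ _)).trans hsub
      · rw [mul_div_cancel_left₀ _ hε.ne']
        exact min_le_right _ _)
  obtain ⟨w, hwlip, hw, hw0⟩ := exists_lipschitzWith_glue hdisj
    (fun p x => pyramid_nonneg (p := p) ht x) (fun p x hx => pyramid_eq_zero ht hx)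
    (fun p => lipschitzWith_pyramid ht hK)
  refine ⟨w, K, hwlip, fun x hx => hw0 x fun hx' => hx ?_, ?_⟩
  · obtain ⟨p, hp, hxp⟩ := Set.mem_iUnion₂.1 hx'
    exact (hsT hp).2 (pyramidBase_subset_closedBall hε hneg hxp)
  have hfaces : ∀ᵐ x : ι → ℝ, ∀ p ∈ s, ∀ e ∈ t, p.2 + e ⬝ᵥ (x - p.1) ≠ 0 := by
    rw [ae_ball_iff hsc]
    intro p _
    rw [Filter.eventually_all_finset]
    intro e he
    have he0 : e ≠ 0 := fun h => h0 (h ▸ htE he)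
    refine measure_mono_null (fun x hx => ?_) (volume_dotProduct_eq he0 (e ⬝ᵥ p.1 - p.2))
    simp only [Set.mem_compl_iff, Set.mem_ofPred_eq, not_not, dotProduct_sub] at hx ⊢
    linarith
  have hcov' : ∀ᵐ x : ι → ℝ, x ∈ Ω → x ∈ ⋃ p ∈ s, pyramidBase t p := by
    refine measure_mono_null (fun x hx => ?_) hcov
    simpa only [Set.mem_compl_iff, Set.mem_ofPred_eq, Classical.not_imp, Set.mem_sdiff] using hx
  filter_upwards [hfaces, hcov', hwlip.ae_differentiableAt] with x hxf hxc hxd hxΩ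
  obtain ⟨p, hp, hxp⟩ := Set.mem_iUnion₂.1 (hxc hxΩ)
  obtain ⟨e, he, hv⟩ := exists_fderiv_eq_dotProduct_of_eqOn_pyramid ht (hw p hp)
    (fun e he => (hxp e he).lt_of_ne (hxf p hp e he).symm) hxd
  exact ⟨hxd, e, htE he, hv⟩

/-- A nonempty open set of rank-one matrices `b ξ ⊗ ξ` spans a space of dimension at least `n`,
and in the case of equality this space consists of all `b ⊗ x` for one fixed vector `b`. -/
theorem le_finrank_of_vecMulVec_mem {m n : ℕ} {V : Submodule ℝ (Matrix (Fin m) (Fin n) ℝ)}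
    {U : Set (Fin n → ℝ)} (hU : IsOpen U) (hUne : U.Nonempty) (b : (Fin n → ℝ) → Fin m → ℝ)
    (hmem : ∀ ξ ∈ U, vecMulVec (b ξ) ξ ∈ V) (i : Fin m) (hb : ∀ ξ ∈ U, b ξ i ≠ 0) :
    n ≤ Module.finrank ℝ V ∧ (Module.finrank ℝ V = n → ∃ b : Fin m → ℝ, b ≠ 0 ∧
      (V : Set (Matrix (Fin m) (Fin n) ℝ)) = {M | ∃ x : Fin n → ℝ, M = vecMulVec b x}) := by
  let R : V →ₗ[ℝ] (Fin n → ℝ) :=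
    { toFun := fun M => (M : Matrix (Fin m) (Fin n) ℝ) i
      map_add' := fun _ _ => rfl
      map_smul' := fun _ _ => rfl }
  let β : (Fin n → ℝ) → Fin m → ℝ := fun ξ => (b ξ i)⁻¹ • b ξ
  have hβi : ∀ ξ ∈ U, β ξ i = 1 := fun ξ hξ => by simp [β, hb ξ hξ]
  have hβmem : ∀ ξ ∈ U, vecMulVec (β ξ) ξ ∈ V := fun ξ hξ => by
    rw [smul_vecMulVec]
    exact V.smul_mem _ (hmem ξ hξ)
  have eq_top : ∀ W : Submodule ℝ (Fin n → ℝ), U ⊆ W → W = ⊤ := fun W hW =>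
    W.eq_top_of_nonempty_interior' (hUne.mono (interior_maximal hW hU))
  have hR : Function.Surjective R := by
    rw [← LinearMap.range_eq_top]
    refine eq_top _ fun ξ hξ => ⟨⟨_, hβmem ξ hξ⟩, ?_⟩
    ext j
    change vecMulVec (β ξ) ξ i j = ξ j
    rw [vecMulVec_apply, hβi ξ hξ, one_mul]
  refine ⟨by simpa using LinearMap.finrank_le_finrank_of_surjective hR, fun hV => ?_⟩
  have hinj : Function.Injective R :=
    (LinearMap.injective_iff_surjective_of_finrank_eq_finrank (by simpa using hV)).2 hR
  have hext : ∀ M ∈ V, ∀ N ∈ V, M i = N i → M = N := fun M hM N hN h =>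
    congrArg Subtype.val (@hinj ⟨M, hM⟩ ⟨N, hN⟩ h)
  obtain ⟨ξ₀, hξ₀U, hξ₀⟩ : ∃ ξ₀ ∈ U, ξ₀ = 0 → ∀ ξ ∈ U, ξ = 0 := by
    by_cases h : ∃ ξ ∈ U, ξ ≠ 0
    · obtain ⟨ξ, hξ, hne⟩ := h
      exact ⟨ξ, hξ, fun h => absurd h hne⟩
    · push Not at h
      obtain ⟨ξ, hξ⟩ := hUne
      exact ⟨ξ, hξ, fun _ => h⟩
  let W : Submodule ℝ (Fin n → ℝ) :=
    { carrier := {ξ | vecMulVec (β ξ₀) ξ ∈ V}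
      add_mem' := fun {x y} hx hy => by
        simp only [Set.mem_ofPred_eq, vecMulVec_add] at *
        exact V.add_mem hx hy
      zero_mem' := by
        have : vecMulVec (β ξ₀) (0 : Fin n → ℝ) = 0 := by
          ext
          simp [vecMulVec_apply]
        simp only [Set.mem_ofPred_eq, this]
        exact V.zero_mem
      smul_mem' := fun c x hx => by
        simp only [Set.mem_ofPred_eq, vecMulVec_smul] at *
        exact V.smul_mem _ hx }
  obtain ⟨ε, hε, hball⟩ := Metric.isOpen_iff.1 hU ξ₀ hξ₀U
  have hW : W = ⊤ := by
    refine W.eq_top_of_nonempty_interior' ⟨ξ₀, mem_interior.2 ⟨_, fun ξ hξ => ?_,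
      Metric.isOpen_ball, Metric.mem_ball_self hε⟩⟩
    have hmid : (1 / 2 : ℝ) • ξ₀ + (1 / 2 : ℝ) • ξ ∈ U :=
      hball (convex_ball ξ₀ ε (Metric.mem_ball_self hε) hξ (by norm_num) (by norm_num)
        (by norm_num))
    have hξU := hball hξ
    set μ := (1 / 2 : ℝ) • ξ₀ + (1 / 2 : ℝ) • ξ with hμ
    have hsum : vecMulVec (β ξ₀) ξ₀ + vecMulVec (β ξ) ξ = (2 : ℝ) • vecMulVec (β μ) μ := by
      refine hext _ (V.add_mem (hβmem _ hξ₀U) (hβmem _ hξU)) _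
        (V.smul_mem _ (hβmem _ hmid)) ?_
      ext j
      simp only [Matrix.add_apply, Matrix.smul_apply, vecMulVec_apply, hβi _ hξ₀U,
        hβi _ hξU, hβi _ hmid, smul_eq_mul]
      simp only [hμ, Pi.add_apply, Pi.smul_apply, smul_eq_mul]
      ring
    have hrow : ∀ k, (β ξ₀ k - β μ k) • ξ₀ = (β μ k - β ξ k) • ξ := by
      intro k
      ext j
      have := congrFun (congrFun hsum k) j
      simp only [Matrix.add_apply, Matrix.smul_apply, vecMulVec_apply, smul_eq_mul] at this
      have hj : μ j = 1 / 2 * ξ₀ j + 1 / 2 * ξ j := by simp [hμ]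
      rw [hj] at this
      simp only [Pi.smul_apply, smul_eq_mul]
      linarith
    by_cases h1 : ∃ k, β μ k - β ξ k ≠ 0
    · obtain ⟨k, hk⟩ := h1
      have : ξ = ((β μ k - β ξ k)⁻¹ * (β ξ₀ k - β μ k)) • ξ₀ := by
        rw [mul_smul, hrow, smul_smul, inv_mul_cancel₀ hk, one_smul]
      rw [this]
      exact W.smul_mem _ (hβmem _ hξ₀U)
    · push Not at h1
      by_cases h2 : ∃ k, β ξ₀ k - β μ k ≠ 0
      · obtain ⟨k, hk⟩ := h2
        have h := hrow k
        rw [h1 k, zero_smul, smul_eq_zero] at h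
        rw [hξ₀ (h.resolve_left hk) ξ hξU]
        exact W.zero_mem
      · push Not at h2
        have : β ξ₀ = β ξ := by
          ext k
          linarith [h1 k, h2 k]
        change vecMulVec (β ξ₀) ξ ∈ V
        rw [this]
        exact hβmem _ hξU
  refine ⟨β ξ₀, fun h => by simpa [h] using hβi ξ₀ hξ₀U, ?_⟩
  have hall : ∀ x, vecMulVec (β ξ₀) x ∈ V := fun x => by
    have : x ∈ W := hW ▸ Submodule.mem_top
    exact this
  ext M
  refine ⟨fun hM => ⟨M i, hext _ hM _ (hall _) ?_⟩, fun ⟨x, hx⟩ => hx ▸ hall x⟩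
  ext j
  simp [vecMulVec_apply, hβi _ hξ₀U]

/-- A convex set whose interior does not contain `0` lies in a closed half-space through `0`. -/
theorem exists_dual_nonneg_of_zero_notMem_interior {F : Type*} [NormedAddCommGroup F]
    [NormedSpace ℝ F] [FiniteDimensional ℝ F] [Nontrivial F] {C : Set F} (hC : Convex ℝ C)
    (h : (0 : F) ∉ interior C) : ∃ f : F →ₗ[ℝ] ℝ, f ≠ 0 ∧ ∀ x ∈ C, 0 ≤ f x := by
  rcases (interior C).eq_empty_or_nonempty with hint | hint
  · have hspan : affineSpan ℝ C ≠ ⊤ := by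
      rw [Ne, ← hC.interior_nonempty_iff_affineSpan_eq_top, hint]
      exact Set.not_nonempty_empty
    have hdir : vectorSpan ℝ C < ⊤ := by
      rcases C.eq_empty_or_nonempty with rfl | hne
      · rw [vectorSpan_empty]
        exact bot_lt_top
      · rw [lt_top_iff_ne_top, ← direction_affineSpan]
        rwa [Ne, AffineSubspace.direction_eq_top_iff_of_nonempty ((affineSpan_nonempty ℝ).2 hne)]
    obtain ⟨f, hf0, hf⟩ := Submodule.exists_le_ker_of_lt_top _ hdir
    have hconst : ∀ x ∈ C, ∀ y ∈ C, f x = f y := fun x hx y hy => by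
      have := hf (vsub_mem_vectorSpan ℝ hx hy)
      rwa [LinearMap.mem_ker, vsub_eq_sub, map_sub, sub_eq_zero] at this
    rcases C.eq_empty_or_nonempty with rfl | ⟨y, hy⟩
    · exact ⟨f, hf0, fun x hx => hx.elim⟩
    rcases le_total 0 (f y) with hy0 | hy0
    · exact ⟨f, hf0, fun x hx => hconst y hy x hx ▸ hy0⟩
    · refine ⟨-f, neg_ne_zero.2 hf0, fun x hx => ?_⟩
      rw [LinearMap.neg_apply, hconst x hx y hy]
      exact neg_nonneg.2 hy0
  · obtain ⟨f, hf0, hf⟩ := geometric_hahn_banach_of_nonempty_interior_point hC h hint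
    refine ⟨-f.toLinearMap, fun h0 => hf0 ?_, fun x hx => ?_⟩
    · ext x
      simpa using LinearMap.congr_fun h0 x
    · simpa using hf x hx

theorem lipschitzWith_cos_dotProduct {ι : Type*} [Fintype ι] (ξ : ι → ℝ) (θ : ℝ) :
    LipschitzWith (∑ i, ‖ξ i‖₊) fun x : ι → ℝ => Real.cos (ξ ⬝ᵥ x + θ) := by
  have h : LipschitzWith (∑ i, ‖ξ i‖₊) fun x : ι → ℝ => ξ ⬝ᵥ x + θ :=
    LipschitzWith.of_le_add_mul _ fun x y => by
      have h1 := (le_abs_self _).trans (abs_dotProduct_le ξ (x - y))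
      rw [dotProduct_sub] at h1
      rw [dist_eq_norm]
      push_cast
      simp only [Real.norm_eq_abs]
      linarith
  simpa only [one_mul] using! Real.lipschitzWith_cos.comp h

theorem lineDeriv_cos_dotProduct {ι : Type*} [Fintype ι] (ξ : ι → ℝ) (θ : ℝ) (x v : ι → ℝ) :
    lineDeriv ℝ (fun x : ι → ℝ => Real.cos (ξ ⬝ᵥ x + θ)) x v =
      -((ξ ⬝ᵥ v) * Real.sin (ξ ⬝ᵥ x + θ)) := by
  refine HasLineDerivAt.lineDeriv (f' := -((ξ ⬝ᵥ v) * Real.sin (ξ ⬝ᵥ x + θ))) ?_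
  have h : HasDerivAt (fun t : ℝ => ξ ⬝ᵥ (x + t • v) + θ) (ξ ⬝ᵥ v) 0 := by
    simp only [dotProduct_add, dotProduct_smul, smul_eq_mul]
    simpa using (((hasDerivAt_id (0 : ℝ)).mul_const (ξ ⬝ᵥ v)).const_add (ξ ⬝ᵥ x)).add_const θ
  have := h.cos
  simp only [zero_smul, add_zero] at this
  exact this.congr_deriv (by ring)

/-- Integration by parts of a compactly supported Lipschitz function against a plane wave. -/
theorem integral_lineDeriv_mul_cos {ι : Type*} [Fintype ι] {w : (ι → ℝ) → ℝ} {K : NNReal}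
    (hw : LipschitzWith K w) (hc : HasCompactSupport w) (ξ v : ι → ℝ) (θ : ℝ) :
    ∫ x, lineDeriv ℝ w x v * Real.cos (ξ ⬝ᵥ x + θ) =
      (ξ ⬝ᵥ v) * ∫ x, w x * Real.sin (ξ ⬝ᵥ x + θ) := by
  have h := (lipschitzWith_cos_dotProduct ξ θ).integral_lineDeriv_mul_eq (μ := volume) hw hc (-v)
  rw [neg_neg] at h
  rw [← h, ← integral_const_mul]
  refine integral_congr_ae (.of_forall fun x => ?_)
  simp only [lineDeriv_cos_dotProduct, dotProduct_neg]
  ring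

theorem integrable_lineDeriv_of_hasCompactSupport {ι : Type*} [Fintype ι] {w : (ι → ℝ) → ℝ}
    {K : NNReal} (hw : LipschitzWith K w) (hc : HasCompactSupport w) (v : ι → ℝ) :
    Integrable fun x => lineDeriv ℝ w x v := by
  have hsub : Function.support (fun x => lineDeriv ℝ w x v) ⊆ tsupport w := by
    intro x hx
    by_contra hxs
    refine hx ?_
    have h0 : w =ᶠ[nhds x] fun _ => 0 := notMem_tsupport_iff_eventuallyEq.1 hxs
    change lineDeriv ℝ w x v = 0
    rw [h0.lineDeriv_eq]
    simp [lineDeriv]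
  rw [← integrableOn_iff_integrable_of_support_subset hsub]
  exact (hw.locallyIntegrable_lineDeriv v).integrableOn_isCompact hc

theorem integrable_lineDeriv_mul_cos {ι : Type*} [Fintype ι] {w : (ι → ℝ) → ℝ}
    {K : NNReal} (hw : LipschitzWith K w) (hc : HasCompactSupport w) (ξ v : ι → ℝ) (θ : ℝ) :
    Integrable fun x => lineDeriv ℝ w x v * Real.cos (ξ ⬝ᵥ x + θ) :=
  (integrable_lineDeriv_of_hasCompactSupport hw hc v).mul_bdd (c := 1)
    (by fun_prop : Continuous fun x : ι → ℝ => Real.cos (ξ ⬝ᵥ x + θ)).aestronglyMeasurable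
    (.of_forall fun x => Real.abs_cos_le_one _)

theorem continuous_integral_mul_sin {ι : Type*} [Fintype ι] {w : (ι → ℝ) → ℝ}
    (hw : Continuous w) (hc : HasCompactSupport w) (θ : ℝ) :
    Continuous fun ξ : ι → ℝ => ∫ x, w x * Real.sin (ξ ⬝ᵥ x + θ) := by
  refine continuous_of_dominated (bound := fun x => ‖w x‖) (fun ξ => ?_) (fun ξ => ?_)
    (hw.integrable_of_hasCompactSupport hc).norm ?_
  · exact Continuous.aestronglyMeasurable (by fun_prop)
  · refine .of_forall fun x => ?_
    rw [norm_mul]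
    exact mul_le_of_le_one_right (norm_nonneg _) (Real.abs_sin_le_one _)
  · exact .of_forall fun x => by fun_prop

/-- A continuous compactly supported function is determined by its sine and cosine transforms. -/
theorem eq_zero_of_integral_mul_sin_eq_zero {ι : Type*} [Fintype ι] {w : (ι → ℝ) → ℝ}
    (hw : Continuous w) (hc : HasCompactSupport w)
    (h : ∀ (θ : ℝ) (ξ : ι → ℝ), ∫ x, w x * Real.sin (ξ ⬝ᵥ x + θ) = 0) : w = 0 := by
  classical
  have hint : Integrable w := hw.integrable_of_hasCompactSupport hc
  let μ₁ : Measure (ι → ℝ) := volume.withDensity fun x => ENNReal.ofReal (w x)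
  let μ₂ : Measure (ι → ℝ) := volume.withDensity fun x => ENNReal.ofReal (-w x)
  have : IsFiniteMeasure μ₁ := isFiniteMeasure_withDensity_ofReal hint.2
  have : IsFiniteMeasure μ₂ := isFiniteMeasure_withDensity_ofReal hint.neg.2
  have hμ : μ₁ = μ₂ := by
    refine Measure.ext_of_charFunDual (funext fun L => ?_)
    let ξ : ι → ℝ := fun j => L (Pi.single j 1)
    have hL : ∀ x, L x = ξ ⬝ᵥ x := fun x => by
      conv_lhs => rw [pi_eq_sum_univ' x]
      simp [ξ, dotProduct, mul_comm]
    let e : (ι → ℝ) → ℂ := fun x => Complex.exp (L x * Complex.I)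
    have hec : Continuous e := by fun_prop
    have he1 : ∀ x, ‖e x‖ = 1 := fun x => Complex.norm_exp_ofReal_mul_I _
    have hm₁ : Measurable fun x => (w x).toNNReal := by fun_prop
    have hm₂ : Measurable fun x => (-w x).toNNReal := by fun_prop
    have hi : ∀ g : (ι → ℝ) → ℝ, Integrable g → Integrable fun x => (g x).toNNReal • e x := by
      intro g hg
      have hg' : Integrable fun x => ((max (g x) 0 : ℝ) : ℂ) := hg.pos_part.ofReal
      refine (hg'.mul_bdd (c := 1) hec.aestronglyMeasurable
        (.of_forall fun x => (he1 x).le)).congr (.of_forall fun x => ?_)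
      simp [NNReal.smul_def, Real.coe_toNNReal']
    have h₁ : charFunDual μ₁ L = ∫ x, (w x).toNNReal • e x :=
      integral_withDensity_eq_integral_smul hm₁ e
    have h₂ : charFunDual μ₂ L = ∫ x, (-w x).toNNReal • e x :=
      integral_withDensity_eq_integral_smul hm₂ e
    rw [h₁, h₂, ← sub_eq_zero, ← integral_sub (hi w hint) (hi (fun x => -w x) hint.neg)]
    have hpt : ∀ x, (w x).toNNReal • e x - (-w x).toNNReal • e x =
        ((w x * Real.sin (ξ ⬝ᵥ x + Real.pi / 2) : ℝ) : ℂ) +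
          ((w x * Real.sin (ξ ⬝ᵥ x + 0) : ℝ) : ℂ) * Complex.I := by
      intro x
      have hsub : ((w x).toNNReal : ℝ) - ((-w x).toNNReal : ℝ) = w x := by
        rw [Real.coe_toNNReal', Real.coe_toNNReal']
        exact max_zero_sub_max_neg_zero_eq_self (w x)
      rw [NNReal.smul_def, NNReal.smul_def, ← sub_smul, hsub, Complex.real_smul]
      simp only [e]
      rw [Complex.exp_mul_I, hL, Real.sin_add_pi_div_two, add_zero]
      push_cast
      ring
    have hs : ∀ θ : ℝ, Integrable fun x => w x * Real.sin (ξ ⬝ᵥ x + θ) := fun θ =>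
      hint.mul_bdd (c := 1)
        (by fun_prop : Continuous fun x => Real.sin (ξ ⬝ᵥ x + θ)).aestronglyMeasurable
        (.of_forall fun x => Real.abs_sin_le_one _)
    rw [integral_congr_ae (.of_forall hpt), integral_add (hs _).ofReal ((hs _).ofReal.mul_const _),
      integral_mul_const, integral_complex_ofReal, integral_complex_ofReal, h, h]
    simp
  have hae := (withDensity_eq_iff_of_sigmaFinite (by fun_prop) (by fun_prop)).1 hμ
  refine (hw.ae_eq_iff_eq volume continuous_zero).1 ?_
  filter_upwards [hae] with x hx
  rcases le_total 0 (w x) with h0 | h0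
  · rw [ENNReal.ofReal_of_nonpos (neg_nonpos.2 h0), ENNReal.ofReal_eq_zero] at hx
    exact le_antisymm hx h0
  · rw [ENNReal.ofReal_of_nonpos h0, eq_comm, ENNReal.ofReal_eq_zero] at hx
    exact le_antisymm h0 (neg_nonpos.1 hx)

theorem lineDeriv_apply_eq_jac_mulVec {m n : ℕ} {u : (Fin n → ℝ) → Fin m → ℝ} {x : Fin n → ℝ}
    (hu : DifferentiableAt ℝ u x) (i : Fin m) (v : Fin n → ℝ) :
    lineDeriv ℝ (fun y => u y i) x v = (jac u x *ᵥ v) i := by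
  have h : HasFDerivAt (fun y => u y i) ((ContinuousLinearMap.proj i).comp (fderiv ℝ u x)) x :=
    hasFDerivAt_pi'.1 hu.hasFDerivAt i
  rw [h.differentiableAt.lineDeriv_eq_fderiv, h.fderiv]
  change fderiv ℝ u x v i = _
  conv_lhs => rw [pi_eq_sum_univ' v]
  simp [jac, mulVec, dotProduct, mul_comm]

/-- The gradient of a Lipschitz function vanishes almost everywhere on its zero set. -/
theorem ae_fderiv_eq_zero_of_eq_zero {ι : Type*} [Fintype ι] {w : (ι → ℝ) → ℝ} {K : NNReal}
    (hw : LipschitzWith K w) {F : Set (ι → ℝ)} (hF : MeasurableSet F) (h0 : ∀ x ∈ F, w x = 0) :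
    ∀ᵐ x, x ∈ F → fderiv ℝ w x = 0 := by
  rcases isEmpty_or_nonempty ι with hι | ⟨⟨j⟩⟩
  · exact .of_forall fun x _ => ContinuousLinearMap.ext fun v => by
      rw [Subsingleton.elim v 0, map_zero, map_zero]
  let f : (ι → ℝ) → ι → ℝ := fun x _ => w x
  have hf : ApproximatesLinearOn f (0 : (ι → ℝ) →L[ℝ] (ι → ℝ))
      (F ∩ {x | DifferentiableAt ℝ w x}) 0 := by
    intro x hx y hy
    have : f x - f y = 0 := by
      ext k
      simp [f, h0 x hx.1, h0 y hy.1]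
    simp [this]
  have hs := hF.inter (measurableSet_of_differentiableAt ℝ w)
  have h := hf.norm_fderiv_sub_le volume hs
    (fun x => ContinuousLinearMap.pi fun _ => fderiv ℝ w x)
    (fun x hx => (hasFDerivAt_pi.2 fun _ => hx.2.hasFDerivAt).hasFDerivWithinAt)
  rw [ae_restrict_iff' hs] at h
  filter_upwards [h, hw.ae_differentiableAt] with x hx hd hxF
  have hx0 := hx ⟨hxF, hd⟩
  rw [nonpos_iff_eq_zero, nnnorm_eq_zero, sub_zero] at hx0
  ext v
  exact congrFun (congrArg (fun L : (ι → ℝ) →L[ℝ] (ι → ℝ) => L v) hx0) j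

theorem LipschitzWith.apply_pi {m n : ℕ} {u : (Fin n → ℝ) → Fin m → ℝ} {C : NNReal}
    (hu : LipschitzWith C u) (i : Fin m) : LipschitzWith C fun x => u x i := by
  simpa only [one_mul] using! (LipschitzWith.eval i).comp hu

theorem ae_jac_eq_zero_of_eq_zero {m n : ℕ} {u : (Fin n → ℝ) → Fin m → ℝ} {C : NNReal}
    (hu : LipschitzWith C u) {F : Set (Fin n → ℝ)} (hF : MeasurableSet F)
    (h0 : ∀ x ∈ F, u x = 0) : ∀ᵐ x, x ∈ F → jac u x = 0 := by
  have h : ∀ᵐ x, ∀ i, x ∈ F → fderiv ℝ (fun y => u y i) x = 0 :=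
    ae_all_iff.2 fun i => ae_fderiv_eq_zero_of_eq_zero (hu.apply_pi i) hF
      fun x hx => congrFun (h0 x hx) i
  filter_upwards [h, hu.ae_differentiableAt] with x hx hd hxF
  ext i j
  have h1 := lineDeriv_apply_eq_jac_mulVec hd i (Pi.single j 1)
  rw [((differentiableAt_pi.1 hd) i).lineDeriv_eq_fderiv, hx i hxF, mulVec_single_one] at h1
  exact h1.symm

theorem LinearMap.apply_eq_sum_single {m n : ℕ} (φ : Matrix (Fin m) (Fin n) ℝ →ₗ[ℝ] ℝ)
    (M : Matrix (Fin m) (Fin n) ℝ) :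
    φ M = ∑ i, ∑ j, φ (Matrix.single i j 1) * M i j := by
  conv_lhs => rw [matrix_eq_sum_single M]
  simp only [map_sum]
  refine Finset.sum_congr rfl fun i _ => Finset.sum_congr rfl fun j _ => ?_
  rw [mul_comm, ← smul_eq_mul, ← map_smul, smul_single, smul_eq_mul, mul_one]

/-- If the Jacobian of `u` takes values in the subspace `V`, then `V` contains the Fourier
transform of the Jacobian. -/
theorem vecMulVec_integral_mul_sin_mem {m n : ℕ} {u : (Fin n → ℝ) → Fin m → ℝ} {C : NNReal}
    (hu : LipschitzWith C u) (hc : HasCompactSupport u)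
    {V : Submodule ℝ (Matrix (Fin m) (Fin n) ℝ)} (hV : ∀ᵐ x, jac u x ∈ V) (θ : ℝ)
    (ξ : Fin n → ℝ) :
    vecMulVec (fun i => ∫ x, u x i * Real.sin (ξ ⬝ᵥ x + θ)) ξ ∈ V := by
  by_contra hnot
  obtain ⟨φ, hφ, hφV⟩ := Submodule.exists_dual_map_eq_bot_of_notMem hnot inferInstance
  refine hφ ?_
  have hφ0 : ∀ M ∈ V, φ M = 0 := fun M hM => by
    have : φ M ∈ V.map φ := Submodule.mem_map_of_mem hM
    rwa [hφV, Submodule.mem_bot] at this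
  have hcomp : ∀ i, HasCompactSupport fun x => u x i := fun i =>
    hc.comp_left (g := fun y : Fin m → ℝ => y i) rfl
  have hint : ∀ i j, Integrable fun x => φ (Matrix.single i j 1) *
      (lineDeriv ℝ (fun y => u y i) x (Pi.single j 1) * Real.cos (ξ ⬝ᵥ x + θ)) := fun i j =>
    (integrable_lineDeriv_mul_cos (hu.apply_pi i) (hcomp i) ξ (Pi.single j 1) θ).const_mul _
  have hzero : ∫ x, ∑ i, ∑ j, φ (Matrix.single i j 1) *
      (lineDeriv ℝ (fun y => u y i) x (Pi.single j 1) * Real.cos (ξ ⬝ᵥ x + θ)) = 0 := by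
    refine integral_eq_zero_of_ae ?_
    filter_upwards [hV, hu.ae_differentiableAt] with x hx hd
    have h1 := hφ0 _ hx
    rw [LinearMap.apply_eq_sum_single] at h1
    simp only [lineDeriv_apply_eq_jac_mulVec hd, mulVec_single_one, col_apply, ← mul_assoc,
      ← Finset.sum_mul, h1, zero_mul, Pi.zero_apply]
  rw [LinearMap.apply_eq_sum_single, ← hzero,
    integral_finsetSum _ fun i _ => integrable_finsetSum _ fun j _ => hint i j]
  refine Finset.sum_congr rfl fun i _ => ?_
  rw [integral_finsetSum _ fun j _ => hint i j]
  refine Finset.sum_congr rfl fun j _ => ?_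
  rw [integral_const_mul, integral_lineDeriv_mul_cos (hu.apply_pi i) (hcomp i),
    dotProduct_single_one, vecMulVec_apply, mul_comm (ξ j)]

/-- The Jacobian of a nonzero compactly supported Lipschitz map of `n` variables cannot take
values in a space of dimension less than `n`, nor in a space of dimension `n` other than
`b ⊗ ℝⁿ`. -/
theorem le_finrank_of_jac_mem {m n : ℕ} {u : (Fin n → ℝ) → Fin m → ℝ} {C : NNReal}
    (hu : LipschitzWith C u) (hc : HasCompactSupport u) (hu0 : u ≠ 0)
    {V : Submodule ℝ (Matrix (Fin m) (Fin n) ℝ)} (hV : ∀ᵐ x, jac u x ∈ V) :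
    n ≤ Module.finrank ℝ V ∧ (Module.finrank ℝ V = n → ∃ b : Fin m → ℝ, b ≠ 0 ∧
      (V : Set (Matrix (Fin m) (Fin n) ℝ)) = {M | ∃ x : Fin n → ℝ, M = vecMulVec b x}) := by
  obtain ⟨i, hi⟩ : ∃ i, (fun x => u x i) ≠ 0 := by
    by_contra! h
    exact hu0 (funext fun x => funext fun i => congrFun (h i) x)
  have hci : HasCompactSupport fun x => u x i :=
    hc.comp_left (g := fun y : Fin m → ℝ => y i) rfl
  obtain ⟨θ, ξ, hξ⟩ : ∃ (θ : ℝ) (ξ : Fin n → ℝ),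
      ∫ x, u x i * Real.sin (ξ ⬝ᵥ x + θ) ≠ 0 := by
    by_contra! h
    exact hi (eq_zero_of_integral_mul_sin_eq_zero (hu.apply_pi i).continuous hci h)
  have hcont := continuous_integral_mul_sin (hu.apply_pi i).continuous hci θ
  exact le_finrank_of_vecMulVec_mem (isOpen_ne_fun hcont continuous_const) ⟨ξ, hξ⟩
    (fun ξ i => ∫ x, u x i * Real.sin (ξ ⬝ᵥ x + θ))
    (fun ξ _ => vecMulVec_integral_mul_sin_mem hu hc hV θ ξ) i fun ξ hξ => hξ

theorem zero_mem_intrinsicInterior_convexHull_iff {m n : ℕ}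
    {E : Set (Matrix (Fin m) (Fin n) ℝ)} {b : Fin m → ℝ} (hb : b ≠ 0)
    (hspan : (Submodule.span ℝ E : Set (Matrix (Fin m) (Fin n) ℝ)) =
      {M | ∃ x : Fin n → ℝ, M = vecMulVec b x}) :
    (0 : Matrix (Fin m) (Fin n) ℝ) ∈ intrinsicInterior ℝ (convexHull ℝ E) ↔
      (0 : Fin n → ℝ) ∈ interior (convexHull ℝ {x | vecMulVec b x ∈ E}) := by
  obtain ⟨i, hi⟩ : ∃ i, b i ≠ 0 := Function.ne_iff.1 hb
  let T : (Fin n → ℝ) →ₗ[ℝ] Matrix (Fin m) (Fin n) ℝ :=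
    { toFun := fun x => vecMulVec b x
      map_add' := fun x y => vecMulVec_add b x y
      map_smul' := fun c x => vecMulVec_smul c b x }
  have hrow : ∀ x, (b i)⁻¹ • T x i = x := fun x => by
    ext j
    change (b i)⁻¹ * (b i * x j) = x j
    rw [inv_mul_cancel_left₀ hi]
  have hinj : Function.Injective T := fun x y h => by rw [← hrow x, h, hrow]
  have hTspan : ∀ x, T x ∈ Submodule.span ℝ E := fun x => by
    have : T x ∈ (Submodule.span ℝ E : Set (Matrix (Fin m) (Fin n) ℝ)) := hspan ▸ ⟨x, rfl⟩
    exact this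
  have hspanT : ∀ M ∈ Submodule.span ℝ E, ∃ x, M = T x := fun M hM => by
    have : M ∈ (Submodule.span ℝ E : Set (Matrix (Fin m) (Fin n) ℝ)) := hM
    rwa [hspan] at this
  have hE : E = T '' {x | vecMulVec b x ∈ E} := by
    ext M
    refine ⟨fun hM => ?_, fun ⟨x, hx, hxM⟩ => hxM ▸ hx⟩
    obtain ⟨x, rfl⟩ := hspanT M (Submodule.subset_span hM)
    exact ⟨x, hM, rfl⟩
  set E' : Set (Fin n → ℝ) := {x | vecMulVec b x ∈ E}
  have hconv : ∀ x, T x ∈ convexHull ℝ E ↔ x ∈ convexHull ℝ E' := fun x => by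
    rw [hE, ← T.image_convexHull, hinj.mem_set_image]
  have hTcont : Continuous T := T.continuous_of_finiteDimensional
  rw [mem_intrinsicInterior]
  constructor
  · rintro ⟨y, hy, hy0⟩
    have h0 : (0 : Matrix (Fin m) (Fin n) ℝ) ∈ affineSpan ℝ (convexHull ℝ E) := hy0 ▸ y.2
    have hmem : ∀ x, T x ∈ affineSpan ℝ (convexHull ℝ E) := by
      intro x
      have hdir : Submodule.span ℝ E ≤ (affineSpan ℝ (convexHull ℝ E)).direction := by
        rw [Submodule.span_le]
        intro M hM
        have := AffineSubspace.vsub_mem_direction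
          (subset_affineSpan ℝ _ (subset_convexHull ℝ E hM)) h0
        simpa using this
      simpa using (AffineSubspace.vadd_mem_iff_mem_direction (T x) h0).2 (hdir (hTspan x))
    let T' : (Fin n → ℝ) → affineSpan ℝ (convexHull ℝ E) := fun x => ⟨T x, hmem x⟩
    have hT' : Continuous T' := hTcont.subtype_mk hmem
    refine mem_interior.2 ⟨T' ⁻¹' interior (Subtype.val ⁻¹' convexHull ℝ E), fun x hx => ?_,
      isOpen_interior.preimage hT', ?_⟩
    · have hx' : T' x ∈ Subtype.val ⁻¹' convexHull ℝ E := interior_subset hx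
      exact (hconv x).1 hx'
    · have : T' 0 = y := Subtype.ext ((map_zero T).trans hy0.symm)
      rw [Set.mem_preimage, this]
      exact hy
  · intro h
    have h0 : (0 : Matrix (Fin m) (Fin n) ℝ) ∈ affineSpan ℝ (convexHull ℝ E) := by
      refine subset_affineSpan ℝ _ ?_
      rw [← map_zero T, hconv]
      exact interior_subset h
    let R : affineSpan ℝ (convexHull ℝ E) → Fin n → ℝ := fun M =>
      (b i)⁻¹ • (M : Matrix (Fin m) (Fin n) ℝ) i
    have hR : Continuous R :=
      continuous_pi fun j => continuous_const.mul (continuous_subtype_val.matrix_elem i j)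
    refine ⟨⟨0, h0⟩, mem_interior.2 ⟨R ⁻¹' interior (convexHull ℝ E'), fun M hM => ?_,
      isOpen_interior.preimage hR, ?_⟩, rfl⟩
    · have hMspan : (M : Matrix (Fin m) (Fin n) ℝ) ∈ Submodule.span ℝ E :=
        affineSpan_subset_span ((affineSpan_convexHull E).le M.2)
      obtain ⟨x, hx⟩ := hspanT _ hMspan
      have hRx : R M = x := by
        simp only [R, hx, hrow]
      have hxint : x ∈ interior (convexHull ℝ E') := hRx ▸ hM
      change (M : Matrix (Fin m) (Fin n) ℝ) ∈ convexHull ℝ E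
      rw [hx, hconv]
      exact interior_subset hxint
    · have : R ⟨0, h0⟩ = 0 := smul_zero _
      rw [Set.mem_preimage, this]
      exact h

/-- A compactly supported Lipschitz function is constant along every direction in which it is
almost everywhere nondecreasing. -/
theorem ae_lineDeriv_eq_zero_of_nonneg {ι : Type*} [Fintype ι] {w : (ι → ℝ) → ℝ} {K : NNReal}
    (hw : LipschitzWith K w) (hc : HasCompactSupport w) {v : ι → ℝ}
    (h : ∀ᵐ x, 0 ≤ lineDeriv ℝ w x v) : ∀ᵐ x, lineDeriv ℝ w x v = 0 := by
  have hint : ∫ x, lineDeriv ℝ w x v = 0 := by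
    simpa using integral_lineDeriv_mul_cos hw hc 0 v 0
  exact (integral_eq_zero_iff_of_nonneg_ae h (integrable_lineDeriv_of_hasCompactSupport hw hc v)).1
    hint

theorem zero_mem_interior_convexHull_of_jac_mem {m n : ℕ} (hn : n ≠ 0)
    {u : (Fin n → ℝ) → Fin m → ℝ} {C : NNReal} (hu : LipschitzWith C u)
    (hc : HasCompactSupport u) (hu0 : u ≠ 0) {b : Fin m → ℝ} (hb : b ≠ 0)
    {S : Set (Fin n → ℝ)}
    (hS : ∀ᵐ x, jac u x = 0 ∨ ∃ y ∈ S, jac u x = vecMulVec b y) :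
    (0 : Fin n → ℝ) ∈ interior (convexHull ℝ S) := by
  by_contra hnot
  have : NeZero n := ⟨hn⟩
  obtain ⟨i, hi⟩ : ∃ i, b i ≠ 0 := Function.ne_iff.1 hb
  obtain ⟨L, hL0, hL⟩ := exists_dual_nonneg_of_zero_notMem_interior (convex_convexHull ℝ S) hnot
  let v : Fin n → ℝ := fun j => L (Pi.single j 1)
  have hLv : ∀ x, L x = x ⬝ᵥ v := fun x => by
    conv_lhs => rw [pi_eq_sum_univ' x]
    simp [v, dotProduct]
  let T : (Fin n → ℝ) →ₗ[ℝ] Matrix (Fin m) (Fin n) ℝ :=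
    { toFun := fun x => vecMulVec b x
      map_add' := fun x y => vecMulVec_add b x y
      map_smul' := fun c x => vecMulVec_smul c b x }
  have hw : LipschitzWith (‖(b i)⁻¹‖₊ * C) fun x => (b i)⁻¹ * u x i :=
    (lipschitzWith_smul (b i)⁻¹).comp (hu.apply_pi i)
  have hwc : HasCompactSupport fun x => (b i)⁻¹ * u x i :=
    hc.comp_left (g := fun y : Fin m → ℝ => (b i)⁻¹ * y i) (mul_zero _)
  have hderiv : ∀ x, DifferentiableAt ℝ u x →
      lineDeriv ℝ (fun y => (b i)⁻¹ * u y i) x v = (b i)⁻¹ * (jac u x *ᵥ v) i := fun x hd => by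
    have hdi := (differentiableAt_pi.1 hd) i
    rw [← lineDeriv_apply_eq_jac_mulVec hd, (hdi.const_mul _).lineDeriv_eq_fderiv,
      hdi.lineDeriv_eq_fderiv, fderiv_const_mul hdi]
    rfl
  have hderiv' : ∀ x y, DifferentiableAt ℝ u x → jac u x = vecMulVec b y →
      lineDeriv ℝ (fun y => (b i)⁻¹ * u y i) x v = L y := fun x y hd hy => by
    rw [hderiv x hd, hy, vecMulVec_mulVec, hLv]
    simp [hi]
  have hzero := ae_lineDeriv_eq_zero_of_nonneg hw hwc (v := v) <| by
    filter_upwards [hS, hu.ae_differentiableAt] with x hx hd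
    rcases hx with hx | ⟨y, hy, hx⟩
    · simp [hderiv x hd, hx]
    · rw [hderiv' x y hd hx]
      exact hL y (subset_convexHull ℝ S hy)
  have hker : ∀ᵐ x, jac u x ∈ (LinearMap.ker L).map T := by
    filter_upwards [hS, hu.ae_differentiableAt, hzero] with x hx hd hx0
    rcases hx with hx | ⟨y, hy, hx⟩
    · rw [hx]
      exact Submodule.zero_mem _
    · rw [hderiv' x y hd hx] at hx0
      exact ⟨y, hx0, hx.symm⟩
  have hrank := (le_finrank_of_jac_mem hu hc hu0 hker).1.trans (Submodule.finrank_map_le T _)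
  refine hL0 (LinearMap.ker_eq_top.1 (Submodule.eq_top_of_finrank_eq ?_))
  exact le_antisymm (Submodule.finrank_le _) (by simpa using hrank)

theorem exists_lipschitzWith_jac_mem {m n : ℕ} {Ω : Set (Fin n → ℝ)} (hΩ : IsOpen Ω)
    {E : Set (Matrix (Fin m) (Fin n) ℝ)} (h0 : (0 : Matrix (Fin m) (Fin n) ℝ) ∉ E)
    {b : Fin m → ℝ} (h : (0 : Fin n → ℝ) ∈ interior (convexHull ℝ {x | vecMulVec b x ∈ E})) :
    ∃ (u : (Fin n → ℝ) → Fin m → ℝ) (C : NNReal), LipschitzWith C u ∧ (∀ x ∉ Ω, u x = 0) ∧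
      ∀ᵐ x, x ∈ Ω → jac u x ∈ E := by
  have hE' : (0 : Fin n → ℝ) ∉ {x | vecMulVec b x ∈ E} := fun hmem => by
    have h1 : vecMulVec b (0 : Fin n → ℝ) = 0 := by
      ext
      simp [vecMulVec_apply]
    rw [Set.mem_ofPred_eq, h1] at hmem
    exact h0 hmem
  obtain ⟨w, K, hw, hoff, hae⟩ := exists_lipschitzWith_gradient_mem hΩ hE' h
  refine ⟨fun x => w x • b, ‖b‖₊ * K, ?_, fun x hx => by simp [hoff x hx], ?_⟩
  · refine LipschitzWith.comp (g := w) (f := fun t : ℝ => t • b) ?_ hw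
    refine LipschitzWith.of_dist_le_mul fun s t => ?_
    rw [dist_eq_norm, ← sub_smul, norm_smul, mul_comm, dist_eq_norm, coe_nnnorm]
  · filter_upwards [hae] with x hx hxΩ
    obtain ⟨hd, e, he, hgrad⟩ := hx hxΩ
    have : jac (fun x => w x • b) x = vecMulVec b e := by
      ext i j
      rw [jac, of_apply, fderiv_smul_const hd, vecMulVec_apply]
      simp [hgrad, mul_comm]
    rw [this]
    exact he

/-- For `Ω ⊆ ℝⁿ` open, bounded, nonempty and `E ⊆ ℝ^{m×n}` with `0 ∉ E` and
`dim span E = n`, there exists `u ∈ W₀^{1,∞}(Ω; ℝᵐ)` with `Du ∈ E` a.e. in `Ω` iff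
`0 ∈ ri (co E)` and `span E = b ⊗ ℝⁿ` for some nonzero `b ∈ ℝᵐ`. -/
theorem stmt9 {m n : ℕ} (Ω : Set (Fin n → ℝ)) (hΩo : IsOpen Ω)
    (hΩb : Bornology.IsBounded Ω) (hΩne : Ω.Nonempty)
    (E : Set (Matrix (Fin m) (Fin n) ℝ)) (h0E : (0 : Matrix (Fin m) (Fin n) ℝ) ∉ E)
    (hdim : Module.finrank ℝ (Submodule.span ℝ E) = n) :
    (∃ (u : (Fin n → ℝ) → (Fin m → ℝ)) (C : NNReal), LipschitzWith C u ∧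
        (∀ x ∉ Ω, u x = 0) ∧
        (∀ᵐ x ∂(volume : Measure (Fin n → ℝ)), x ∈ Ω → jac u x ∈ E)) ↔
      ((0 : Matrix (Fin m) (Fin n) ℝ) ∈ intrinsicInterior ℝ (convexHull ℝ E) ∧
        ∃ b : Fin m → ℝ, b ≠ 0 ∧
          (Submodule.span ℝ E : Set (Matrix (Fin m) (Fin n) ℝ)) =
            {M | ∃ x : Fin n → ℝ, M = vecMulVec b x}) := by
  constructor
  · rintro ⟨u, C, hu, hoff, hae⟩
    obtain ⟨x₀, hx₀, hjac⟩ : ∃ x ∈ Ω, jac u x ∈ E := by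
      have : (volume.restrict Ω : Measure (Fin n → ℝ)) ≠ 0 := by
        rw [Ne, Measure.restrict_eq_zero]
        exact (hΩo.measure_pos volume hΩne).ne'
      have : (ae (volume.restrict Ω)).NeBot := ae_neBot.2 this
      have h := (ae_restrict_iff' hΩo.measurableSet).2 hae
      exact ((ae_restrict_mem hΩo.measurableSet).and h).exists
    have hu0 : u ≠ 0 := by
      rintro rfl
      refine h0E ?_
      convert hjac
      ext i j
      simp [jac, fderiv_zero]
    have hn : n ≠ 0 := by
      rintro rfl
      exact h0E (Subsingleton.elim (jac u x₀) 0 ▸ hjac)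
    have hc : HasCompactSupport u := HasCompactSupport.of_support_subset_isCompact
      hΩb.isCompact_closure fun x hx => subset_closure (not_imp_comm.1 (hoff x) hx)
    have hzero := ae_jac_eq_zero_of_eq_zero hu hΩo.measurableSet.compl hoff
    have hspan : ∀ᵐ x, jac u x ∈ Submodule.span ℝ E := by
      filter_upwards [hae, hzero] with x hx hx0
      by_cases hxΩ : x ∈ Ω
      · exact Submodule.subset_span (hx hxΩ)
      · rw [hx0 hxΩ]
        exact Submodule.zero_mem _
    obtain ⟨b, hb, hbE⟩ := (le_finrank_of_jac_mem hu hc hu0 hspan).2 hdim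
    refine ⟨?_, b, hb, hbE⟩
    rw [zero_mem_intrinsicInterior_convexHull_iff hb hbE]
    refine zero_mem_interior_convexHull_of_jac_mem hn hu hc hu0 hb ?_
    filter_upwards [hae, hzero] with x hx hx0
    by_cases hxΩ : x ∈ Ω
    · have hmem : jac u x ∈ (Submodule.span ℝ E : Set (Matrix (Fin m) (Fin n) ℝ)) :=
        Submodule.subset_span (hx hxΩ)
      rw [hbE] at hmem
      obtain ⟨y, hy⟩ := hmem
      exact Or.inr ⟨y, hy ▸ hx hxΩ, hy⟩
    · exact Or.inl (hx0 hxΩ)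
  · rintro ⟨h, b, hb, hbE⟩
    exact exists_lipschitzWith_jac_mem hΩo h0E
      ((zero_mem_intrinsicInterior_convexHull_iff hb hbE).1 h)
end
end
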